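/- Let a₁ = (1/2)√(3/2), a₂ = (1/2)(18 − 7√6), 𝐖(ρ) = −1/(a₁ρ² + a₂), f₁(ρ) = −9(1 + ρ² 𝐖(ρ)), f₂(ρ) = −3ρ², and for a radial function u on ℝ⁷ set N(u)(x) := f₁(|x|) u(x)² + f₂(|x|) u(x)³. There exists a constant C > 0 such that for all radial u₁, u₂ ∈ C_c^∞(ℝ⁷, ℝ) with ‖u₁‖ ≤ 1 and ‖u₂‖ ≤ 1: ‖N(u₁) − N(u₂)‖ ≤ C ( ‖u₁‖ + ‖u₂‖ ) ‖u₁ − u₂‖. -/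

import Mathlib

open MeasureTheory Set
open scoped ENNReal

noncomputable section

abbrev E7 := EuclideanSpace ℝ (Fin 7)

/-- The Laplacian on `ℝ⁷`: `Δf(x) = ∑ᵢ ∂ᵢ²f(x)`. -/
def lap (f : E7 → ℝ) (x : E7) : ℝ :=
  ∑ i : Fin 7, iteratedFDeriv ℝ 2 f x ![EuclideanSpace.single i 1, EuclideanSpace.single i 1]

/-- A function on `ℝ⁷` is radial if it only depends on the norm of its argument. -/
def IsRadial (f : E7 → ℝ) : Prop := ∀ x y : E7, ‖x‖ = ‖y‖ → f x = f y

/-- `‖f‖² = ‖Δf‖²_{L²(ℝ⁷)} + ‖Δ²f‖²_{L²(ℝ⁷)}`. -/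
def HnormSq (f : E7 → ℝ) : ℝ≥0∞ :=
  (∫⁻ x, ENNReal.ofReal ((lap f x)^2)) + (∫⁻ x, ENNReal.ofReal ((lap (lap f) x)^2))

/-- `‖f‖ = (‖Δf‖² + ‖Δ²f‖²)^{1/2}`. -/
def Hnorm (f : E7 → ℝ) : ℝ≥0∞ := HnormSq f ^ ((1:ℝ)/2)

/-- `a₁ = (1/2)√(3/2)`. -/
def a1 : ℝ := (1/2) * Real.sqrt (3/2)

/-- `a₂ = (1/2)(18 − 7√6)`. -/
def a2 : ℝ := (1/2) * (18 - 7 * Real.sqrt 6)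

/-- The Weinkove profile `𝐖(ρ) = −1/(a₁ρ² + a₂)`. -/
def Wprof (ρ : ℝ) : ℝ := -(1 / (a1 * ρ^2 + a2))

/-- `f₁(ρ) = −9(1 + ρ²𝐖(ρ))`. -/
def f1 (ρ : ℝ) : ℝ := -9 * (1 + ρ^2 * Wprof ρ)

/-- `f₂(ρ) = −3ρ²`. -/
def f2 (ρ : ℝ) : ℝ := -3 * ρ^2

/-- The nonlinearity `N(u)(x) = f₁(|x|)u(x)² + f₂(|x|)u(x)³`. -/
def Nonlin (u : E7 → ℝ) (x : E7) : ℝ := f1 ‖x‖ * (u x)^2 + f2 ‖x‖ * (u x)^3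


/-! ### Radial calculus -/

theorem hasFDerivAt_radial {F : E7 → ℝ} {p0 p1 : ℝ → ℝ}
    (h0 : ∀ x, x ≠ 0 → F x = p0 (‖x‖^2)) (h1 : ∀ t, 0 < t → HasDerivAt p0 (p1 t) t)
    {x : E7} (hx : x ≠ 0) :
    HasFDerivAt F (p1 (‖x‖^2) • ((2:ℝ) • innerSL ℝ x)) x := by
  have hpos : 0 < ‖x‖^2 := by positivity
  have hq : HasFDerivAt (fun y : E7 => ‖y‖^2) ((2:ℝ) • innerSL ℝ x) x := by
    have := (hasStrictFDerivAt_norm_sq x).hasFDerivAt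
    rwa [← Nat.cast_smul_eq_nsmul ℝ] at this
  have h2 := (h1 _ hpos).comp_hasFDerivAt x hq
  refine h2.congr_of_eventuallyEq ?_
  filter_upwards [isOpen_ne.mem_nhds hx] with y hy
  exact h0 y hy

theorem lap_radial {F : E7 → ℝ} {p0 p1 p2 : ℝ → ℝ}
    (h0 : ∀ x, x ≠ 0 → F x = p0 (‖x‖^2)) (h1 : ∀ t, 0 < t → HasDerivAt p0 (p1 t) t)
    (h2 : ∀ t, 0 < t → HasDerivAt p1 (p2 t) t)
    {x : E7} (hx : x ≠ 0) :
    lap F x = 4 * ‖x‖^2 * p2 (‖x‖^2) + 14 * p1 (‖x‖^2) := by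
  have hev : fderiv ℝ F =ᶠ[nhds x] fun y => p1 (‖y‖^2) • ((2:ℝ) • innerSL ℝ y) := by
    filter_upwards [isOpen_ne.mem_nhds hx] with y hy
    exact (hasFDerivAt_radial h0 h1 hy).fderiv
  have hp1 : HasFDerivAt (fun y : E7 => p1 (‖y‖^2)) (p2 (‖x‖^2) • ((2:ℝ) • innerSL ℝ x)) x :=
    hasFDerivAt_radial (fun _ _ => rfl) h2 hx
  have hin : HasFDerivAt (fun y : E7 => (2:ℝ) • innerSL ℝ y) ((2:ℝ) • innerSL ℝ (E := E7)) x :=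
    ((innerSL ℝ (E := E7)).hasFDerivAt (x := x)).const_smul (2:ℝ)
  have hd := (hp1.smul hin).congr_of_eventuallyEq hev
  unfold lap
  have : ∀ i : Fin 7, iteratedFDeriv ℝ 2 F x ![EuclideanSpace.single i 1, EuclideanSpace.single i 1]
      = 4 * p2 (‖x‖^2) * (x i)^2 + 2 * p1 (‖x‖^2) := by
    intro i
    rw [iteratedFDeriv_two_apply, hd.fderiv]
    have e1 : (innerSL ℝ (EuclideanSpace.single i (1:ℝ) : E7)) (EuclideanSpace.single i (1:ℝ)) = 1 := by
      rw [innerSL_apply_apply]; simp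
    simp [EuclideanSpace.inner_single_right, e1]
    ring
  rw [Finset.sum_congr rfl (fun i _ => this i), Finset.sum_add_distrib, ← Finset.mul_sum,
    ← EuclideanSpace.real_norm_sq_eq]
  simp
  ring

/-- A jet of derivatives in the variable `t = |x|²`. -/
structure Jet (p : ℕ → ℝ → ℝ) : Prop where
  der : ∀ k, k < 4 → ∀ t, 0 < t → HasDerivAt (p k) (p (k+1) t) t

def op2 (p : ℕ → ℝ → ℝ) (t : ℝ) : ℝ := 4 * t * p 2 t + 14 * p 1 t
def op4 (p : ℕ → ℝ → ℝ) (t : ℝ) : ℝ := 16 * t^2 * p 4 t + 144 * t * p 3 t + 252 * p 2 t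

theorem Jet.lap_eq {p : ℕ → ℝ → ℝ} (hp : Jet p) {F : E7 → ℝ}
    (h0 : ∀ x, x ≠ 0 → F x = p 0 (‖x‖^2)) {x : E7} (hx : x ≠ 0) :
    lap F x = op2 p (‖x‖^2) :=
  lap_radial h0 (hp.der 0 (by norm_num)) (hp.der 1 (by norm_num)) hx

theorem Jet.op2_der {p : ℕ → ℝ → ℝ} (hp : Jet p) (t : ℝ) (ht : 0 < t) :
    HasDerivAt (op2 p) (4 * t * p 3 t + 18 * p 2 t) t := by
  have := (((hasDerivAt_id t).const_mul 4).mul (hp.der 2 (by norm_num) t ht)).add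
    ((hp.der 1 (by norm_num) t ht).const_mul 14)
  refine this.congr_deriv ?_
  simp; ring

theorem Jet.laplap_eq {p : ℕ → ℝ → ℝ} (hp : Jet p) {F : E7 → ℝ}
    (h0 : ∀ x, x ≠ 0 → F x = p 0 (‖x‖^2)) {x : E7} (hx : x ≠ 0) :
    lap (lap F) x = op4 p (‖x‖^2) := by
  have h2 : ∀ t, 0 < t → HasDerivAt (fun t => 4 * t * p 3 t + 18 * p 2 t)
      (4 * t * p 4 t + 22 * p 3 t) t := by
    intro t ht
    have := (((hasDerivAt_id t).const_mul 4).mul (hp.der 3 (by norm_num) t ht)).add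
      ((hp.der 2 (by norm_num) t ht).const_mul 18)
    refine this.congr_deriv ?_
    simp; ring
  rw [lap_radial (fun x hx => hp.lap_eq h0 hx) hp.op2_der h2 hx]
  unfold op4; ring

/-- product of jets -/
def mulJet (a b : ℕ → ℝ → ℝ) : ℕ → ℝ → ℝ
  | 0 => fun t => a 0 t * b 0 t
  | 1 => fun t => a 1 t * b 0 t + a 0 t * b 1 t
  | 2 => fun t => a 2 t * b 0 t + 2 * (a 1 t * b 1 t) + a 0 t * b 2 t
  | 3 => fun t => a 3 t * b 0 t + 3 * (a 2 t * b 1 t) + 3 * (a 1 t * b 2 t) + a 0 t * b 3 t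
  | 4 => fun t => a 4 t * b 0 t + 4 * (a 3 t * b 1 t) + 6 * (a 2 t * b 2 t) + 4 * (a 1 t * b 3 t)
      + a 0 t * b 4 t
  | _ => fun _ => 0

theorem Jet.mul {a b : ℕ → ℝ → ℝ} (ha : Jet a) (hb : Jet b) : Jet (mulJet a b) := by
  refine ⟨fun k hk t ht => ?_⟩
  have A0 := ha.der 0 (by norm_num) t ht
  have A1 := ha.der 1 (by norm_num) t ht
  have A2 := ha.der 2 (by norm_num) t ht
  have A3 := ha.der 3 (by norm_num) t ht
  have B0 := hb.der 0 (by norm_num) t ht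
  have B1 := hb.der 1 (by norm_num) t ht
  have B2 := hb.der 2 (by norm_num) t ht
  have B3 := hb.der 3 (by norm_num) t ht
  interval_cases k
  · exact A0.mul B0
  · refine ((A1.mul B0).add (A0.mul B1)).congr_deriv ?_
    simp only [mulJet]; ring
  · refine (((A2.mul B0).add ((A1.mul B1).const_mul 2)).add (A0.mul B2)).congr_deriv ?_
    simp only [mulJet]; ring
  · refine ((((A3.mul B0).add ((A2.mul B1).const_mul 3)).add ((A1.mul B2).const_mul 3)).add
      (A0.mul B3)).congr_deriv ?_
    simp only [mulJet]; ring

theorem Jet.add {a b : ℕ → ℝ → ℝ} (ha : Jet a) (hb : Jet b) : Jet (fun k t => a k t + b k t) :=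
  ⟨fun k hk t ht => (ha.der k hk t ht).add (hb.der k hk t ht)⟩

/-- the jet of `t` -/
def tJet : ℕ → ℝ → ℝ
  | 0 => fun t => t
  | 1 => fun _ => 1
  | _ => fun _ => 0

theorem tJet_jet : Jet tJet := by
  refine ⟨fun k hk t ht => ?_⟩
  interval_cases k
  · exact hasDerivAt_id t
  · exact hasDerivAt_const t 1
  · exact hasDerivAt_const t 0
  · exact hasDerivAt_const t 0

theorem a1_pos : 0 < a1 := by unfold a1; positivity

theorem a2_pos : 0 < a2 := by
  unfold a2
  have : Real.sqrt 6 < 18/7 := by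
    rw [Real.sqrt_lt' (by norm_num)]; norm_num
  linarith

/-- the jet of `f₁` -/
def fJet : ℕ → ℝ → ℝ
  | 0 => fun t => -9 * (1 - 1/a1) - 9 * (a2/a1) * (a1 * t + a2)⁻¹
  | 1 => fun t => 9 * a2 * ((a1 * t + a2)⁻¹)^2
  | 2 => fun t => -18 * a2 * a1 * ((a1 * t + a2)⁻¹)^3
  | 3 => fun t => 54 * a2 * a1^2 * ((a1 * t + a2)⁻¹)^4
  | 4 => fun t => -216 * a2 * a1^3 * ((a1 * t + a2)⁻¹)^5
  | _ => fun _ => 0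

theorem fJet_jet : Jet fJet := by
  refine ⟨fun k hk t ht => ?_⟩
  have h1 := a1_pos
  have h2 := a2_pos
  have hpos : 0 < a1 * t + a2 := by positivity
  have hi : HasDerivAt (fun t => (a1 * t + a2)⁻¹) (-a1 * ((a1 * t + a2)⁻¹)^2) t := by
    have := (((hasDerivAt_id t).const_mul a1).add_const a2).inv hpos.ne'
    refine this.congr_deriv ?_
    simp; field_simp
  interval_cases k
  · refine (((hi.const_mul (9 * (a2/a1))).const_sub (-9 * (1 - 1/a1)))).congr_deriv ?_
    simp only [fJet]; field_simp
  · refine ((hi.pow 2).const_mul (9*a2)).congr_deriv ?_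
    simp only [fJet]; push_cast; ring
  · refine ((hi.pow 3).const_mul (-18 * a2 * a1)).congr_deriv ?_
    simp only [fJet]; push_cast; ring
  · refine ((hi.pow 4).const_mul (54 * a2 * a1^2)).congr_deriv ?_
    simp only [fJet]; push_cast; ring

theorem f1_eq (ρ : ℝ) : f1 ρ = fJet 0 (ρ^2) := by
  have h1 := a1_pos
  have h2 := a2_pos
  have hpos : 0 < a1 * ρ^2 + a2 := by positivity
  simp only [f1, Wprof, fJet]
  field_simp
  ring

/-! ### Bounded functions on the half line with bounded support -/

def Bd (f : ℝ → ℝ) : Prop :=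
  ContinuousOn f (Ioi 0) ∧ ∃ R C : ℝ, (∀ r, 0 < r → |f r| ≤ C) ∧ ∀ r, R ≤ r → f r = 0

theorem Bd.add {f g : ℝ → ℝ} (hf : Bd f) (hg : Bd g) : Bd (fun r => f r + g r) := by
  obtain ⟨cf, R, C, h1, h2⟩ := hf
  obtain ⟨cg, R', C', h1', h2'⟩ := hg
  refine ⟨cf.add cg, max R R', C + C', fun r hr => ?_, fun r hr => ?_⟩
  · exact (abs_add_le _ _).trans (add_le_add (h1 r hr) (h1' r hr))
  · beta_reduce; rw [h2 r ((le_max_left _ _).trans hr), h2' r ((le_max_right _ _).trans hr), add_zero]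

theorem Bd.mul {f g : ℝ → ℝ} (hf : Bd f) (hg : Bd g) : Bd (fun r => f r * g r) := by
  obtain ⟨cf, R, C, h1, h2⟩ := hf
  obtain ⟨cg, R', C', h1', h2'⟩ := hg
  refine ⟨cf.mul cg, R, C * C', fun r hr => ?_, fun r hr => ?_⟩
  · rw [abs_mul]
    exact mul_le_mul (h1 r hr) (h1' r hr) (abs_nonneg _) ((abs_nonneg _).trans (h1 r hr))
  · beta_reduce; rw [h2 r hr, zero_mul]

theorem Bd.const_mul {f : ℝ → ℝ} (hf : Bd f) (c : ℝ) : Bd (fun r => c * f r) := by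
  obtain ⟨cf, R, C, h1, h2⟩ := hf
  refine ⟨continuousOn_const.mul cf, R, |c| * C, fun r hr => ?_, fun r hr => ?_⟩
  · rw [abs_mul]
    exact mul_le_mul_of_nonneg_left (h1 r hr) (abs_nonneg _)
  · beta_reduce; rw [h2 r hr, mul_zero]

theorem Bd.pow_mul {f : ℝ → ℝ} (hf : Bd f) (n : ℕ) : Bd (fun r => r^n * f r) := by
  obtain ⟨cf, R, C, h1, h2⟩ := hf
  have hC : 0 ≤ C := (abs_nonneg _).trans (h1 1 one_pos)
  refine ⟨(continuous_pow n).continuousOn.mul cf, R, |R|^n * C, fun r hr => ?_, fun r hr => ?_⟩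
  · by_cases hR : R ≤ r
    · beta_reduce; rw [h2 r hR]; simp; positivity
    · rw [abs_mul, abs_pow]
      have : |r| ≤ |R| := by
        rw [abs_of_pos hr, abs_of_pos (by linarith)]; linarith
      exact mul_le_mul (pow_le_pow_left₀ (abs_nonneg _) this n) (h1 r hr) (abs_nonneg _) (by positivity)
  · beta_reduce; rw [h2 r hr, mul_zero]

theorem Bd.integrableOn {f : ℝ → ℝ} (hf : Bd f) : IntegrableOn f (Ioi 0) := by
  obtain ⟨cf, R, C, h1, h2⟩ := hf
  have hsub : IntegrableOn f (Ioc 0 R) := by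
    refine IntegrableOn.of_bound (C := C) (by simp) ?_ ?_
    · exact (cf.mono Ioc_subset_Ioi_self).aestronglyMeasurable measurableSet_Ioc
    · filter_upwards [ae_restrict_mem measurableSet_Ioc] with r hr
      exact h1 r hr.1
  refine hsub.of_forall_sdiff_eq_zero measurableSet_Ioi ?_
  intro x hx
  apply h2
  by_contra h
  exact hx.2 ⟨hx.1, (not_le.mp h).le⟩

/-! ### Profiles of radial test functions -/

structure Prof (p : ℕ → ℝ → ℝ) : Prop where
  jet : Jet p
  c4 : ContinuousOn (p 4) (Ioi 0)
  b0 : Bd (fun r => p 0 (r^2))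
  b1 : Bd (fun r => p 1 (r^2))
  b2 : Bd (fun r => r^2 * p 2 (r^2))
  b3 : Bd (fun r => r^4 * p 3 (r^2))
  b4 : Bd (fun r => r^6 * p 4 (r^2))

def e0 : E7 := EuclideanSpace.single 0 1

theorem norm_e0 : ‖e0‖ = 1 := by simp [e0]

theorem contDiff_lap {u : E7 → ℝ} (hu : ContDiff ℝ (⊤ : ℕ∞) u) : ContDiff ℝ (⊤ : ℕ∞) (lap u) := by
  unfold lap
  refine ContDiff.sum fun i _ => ?_
  have h := hu.iteratedFDeriv_right (m := (⊤ : ℕ∞)) (i := 2) (by norm_cast)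
  exact (ContinuousMultilinearMap.apply ℝ (fun _ : Fin 2 => E7) ℝ
    ![EuclideanSpace.single i 1, EuclideanSpace.single i 1]).contDiff.comp h

section key
variable {f : E7 → ℝ}

theorem contDiff_ray (hf : ContDiff ℝ (⊤ : ℕ∞) f) : ContDiff ℝ (⊤ : ℕ∞) (fun r : ℝ => f (r • e0)) :=
  hf.comp (contDiff_id.smul contDiff_const)

theorem bd_ray (hf : ContDiff ℝ (⊤ : ℕ∞) f) {R : ℝ} (hR : ∀ x, R ≤ ‖x‖ → f x = 0) :
    Bd (fun r : ℝ => f (r • e0)) := by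
  have hcont := (contDiff_ray hf).continuous
  have hcs : HasCompactSupport (fun r : ℝ => f (r • e0)) := by
    refine HasCompactSupport.intro (isCompact_Icc (a := -R) (b := R)) fun r hr => hR _ ?_
    rw [norm_smul, norm_e0, mul_one, Real.norm_eq_abs]
    by_contra h
    exact hr (abs_le.mp (not_le.mp h).le)
  obtain ⟨C, hC⟩ := hcont.bounded_above_of_compact_support hcs
  refine ⟨hcont.continuousOn, R, C, fun r _ => hC r, fun r hr => hR _ ?_⟩
  rw [norm_smul, norm_e0, mul_one]
  exact hr.trans (le_abs_self r)

theorem bd_first (hf : ContDiff ℝ (⊤ : ℕ∞) f) {R : ℝ} (hR : ∀ x, R ≤ ‖x‖ → f x = 0)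
    (hrad : IsRadial f) {p0 p1 : ℝ → ℝ} (h0 : ∀ x, x ≠ 0 → f x = p0 (‖x‖^2))
    (h1 : ∀ t, 0 < t → HasDerivAt p0 (p1 t) t) (hc : ContinuousOn p1 (Ioi 0)) 
    (hz : ∀ r, R ≤ r → p1 (r^2) = 0) :
    Bd (fun r => p1 (r^2)) := by
  set φ : ℝ → ℝ := fun r => f (r • e0) with hφ
  have hφs : ContDiff ℝ (⊤ : ℕ∞) φ := contDiff_ray hf
  have hφ1 : ContDiff ℝ (⊤ : ℕ∞) (deriv φ) := by
    have := ((contDiff_infty_iff_deriv (f := φ)).1 hφs).2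
    exact this
  have hφ2 : Continuous (deriv (deriv φ)) := by
    have := ((contDiff_infty_iff_deriv (f := deriv φ)).1 hφ1).2
    exact this.continuous
  have hcs : HasCompactSupport φ := by
    refine HasCompactSupport.intro (isCompact_Icc (a := -R) (b := R)) fun r hr => hR _ ?_
    rw [norm_smul, norm_e0, mul_one, Real.norm_eq_abs]
    by_contra h
    exact hr (abs_le.mp (not_le.mp h).le)
  obtain ⟨C, hC⟩ := hφ2.bounded_above_of_compact_support hcs.deriv.deriv
  have heven : ∀ r, φ (-r) = φ r := fun r => hrad _ _ (by simp)
  have hd0 : deriv φ 0 = 0 := by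
    have h := deriv_comp_neg φ 0
    have : (fun x => φ (-x)) = φ := funext heven
    rw [this, neg_zero] at h
    linarith
  have hder : ∀ r, 0 < r → deriv φ r = 2 * r * p1 (r^2) := by
    intro r hr
    have hh : HasDerivAt (fun s : ℝ => p0 (s^2)) (p1 (r^2) * (2 * r)) r := by
      have := (h1 (r^2) (by positivity)).comp r (hasDerivAt_pow 2 r)
      refine (this.congr_deriv ?_)
      simp
    have hev : φ =ᶠ[nhds r] fun s => p0 (s^2) := by
      filter_upwards [lt_mem_nhds hr] with s hs
      have hne : s • e0 ≠ 0 := by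
        rw [← norm_ne_zero_iff, norm_smul, norm_e0, mul_one]; simpa using hs.ne'
      rw [hφ]
      simp only
      rw [h0 _ hne, norm_smul, norm_e0, mul_one, Real.norm_eq_abs, sq_abs]
    rw [(hh.congr_of_eventuallyEq hev).deriv]; ring
  refine ⟨hc.comp (continuous_pow 2).continuousOn (fun r hr => by
    have : (0:ℝ) < r := hr
    exact (by positivity : (0:ℝ) < r^2)), R, C, fun r hr => ?_, hz⟩
  have hmv := Convex.norm_image_sub_le_of_norm_deriv_le (f := deriv φ) (s := univ) (C := C)
    (fun x _ => (hφ1.differentiable (by simp)) x) (fun x _ => hC x) convex_univ (mem_univ 0) (mem_univ r)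
  rw [hd0, sub_zero, sub_zero, hder r hr, Real.norm_eq_abs, Real.norm_eq_abs, abs_mul,
    abs_of_pos (by positivity : 0 < 2 * r), abs_of_pos hr] at hmv
  have : r * (2 * |p1 (r^2)|) ≤ r * C := by linarith
  have := le_of_mul_le_mul_left this hr
  have := abs_nonneg (p1 (r^2))
  linarith

end key

theorem exists_prof {u : E7 → ℝ} (hu : ContDiff ℝ (⊤ : ℕ∞) u) (hc : HasCompactSupport u)
    (hrad : IsRadial u) :
    ∃ p : ℕ → ℝ → ℝ, (∀ x, x ≠ 0 → u x = p 0 (‖x‖^2)) ∧ Prof p := by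
  set ψ : ℝ → ℝ := fun t => u (Real.sqrt t • e0) with hψ
  obtain ⟨R, hRpos, hR⟩ : ∃ R : ℝ, 0 < R ∧ ∀ x, R ≤ ‖x‖ → u x = 0 := by
    obtain ⟨R, hR⟩ := hc.isCompact.isBounded.subset_ball 0
    refine ⟨max R 1, by positivity, fun x hx => ?_⟩
    by_contra h
    have := hR (subset_tsupport u h)
    rw [mem_ball_zero_iff] at this
    exact absurd ((le_max_left _ _).trans hx) (not_le.mpr this)
  have hψs : ContDiffOn ℝ (⊤ : ℕ∞) ψ (Ioi 0) := by
    intro t ht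
    have h1 : ContDiffAt ℝ (⊤ : ℕ∞) Real.sqrt t := Real.contDiffAt_sqrt (ne_of_gt ht)
    exact ((contDiff_ray hu).contDiffAt.comp t h1).contDiffWithinAt
  have h0 : ∀ x, x ≠ 0 → u x = iteratedDeriv 0 ψ (‖x‖^2) := by
    intro x _
    rw [iteratedDeriv_zero, hψ]
    simp only
    rw [Real.sqrt_sq (norm_nonneg _)]
    exact hrad _ _ (by simp [norm_smul, norm_e0])
  have hall : ∀ k t, 0 < t → HasDerivAt (iteratedDeriv k ψ) (iteratedDeriv (k+1) ψ t) t := by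
    intro k t ht
    have h1 := hψs.differentiableOn_iteratedDerivWithin (m := k) (by exact_mod_cast ENat.natCast_lt_top k)
      (uniqueDiffOn_Ioi 0) t ht
    have hev : iteratedDerivWithin k ψ (Ioi 0) =ᶠ[nhds t] iteratedDeriv k ψ := by
      filter_upwards [Ioi_mem_nhds ht] with s hs
      exact iteratedDerivWithin_of_isOpen isOpen_Ioi hs
    have h2 : DifferentiableAt ℝ (iteratedDeriv k ψ) t :=
      (h1.differentiableAt (Ioi_mem_nhds ht)).congr_of_eventuallyEq hev.symm
    rw [iteratedDeriv_succ]
    exact h2.hasDerivAt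
  have hjet : Jet (fun k => iteratedDeriv k ψ) := ⟨fun k _ => hall k⟩
  have hzero : ∀ k t, R^2 < t → iteratedDeriv k ψ t = 0 := by
    intro k
    induction k with
    | zero =>
      intro t ht
      rw [iteratedDeriv_zero]
      refine hR _ ?_
      rw [norm_smul, norm_e0, mul_one, Real.norm_eq_abs, abs_of_nonneg (Real.sqrt_nonneg _)]
      exact (Real.le_sqrt hRpos.le (by nlinarith [sq_nonneg R])).2 ht.le
    | succ k ih =>
      intro t ht
      have hev : iteratedDeriv k ψ =ᶠ[nhds t] fun _ => 0 := by
        filter_upwards [Ioi_mem_nhds ht] with s hs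
        exact ih s hs
      exact (hall k t (lt_of_le_of_lt (sq_nonneg R) ht)).unique ((hasDerivAt_const t 0).congr_of_eventuallyEq hev)
  set p : ℕ → ℝ → ℝ := fun k => iteratedDeriv k ψ with hp
  have hcont : ∀ k, ContinuousOn (p k) (Ioi 0) := fun k t ht =>
    (hall k t ht).continuousAt.continuousWithinAt
  have hz : ∀ k r, R + 1 ≤ r → p k (r^2) = 0 := fun k r hr => hzero k _ (by nlinarith)
  have hR1 : ∀ x, R + 1 ≤ ‖x‖ → u x = 0 := fun x hx => hR x (by linarith)
  have hne : ∀ {x : E7}, R + 1 ≤ ‖x‖ → x ≠ 0 := by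
    intro x hx h; rw [h, norm_zero] at hx; linarith
  have hl : ∀ x, x ≠ 0 → lap u x = op2 p (‖x‖^2) := fun x hx => hjet.lap_eq h0 hx
  have hll : ∀ x, x ≠ 0 → lap (lap u) x = op4 p (‖x‖^2) := fun x hx => hjet.laplap_eq h0 hx
  have hlR : ∀ x, R + 1 ≤ ‖x‖ → lap u x = 0 := by
    intro x hx
    rw [hl x (hne hx), op2, hz _ _ hx, hz _ _ hx]; ring
  have hllR : ∀ x, R + 1 ≤ ‖x‖ → lap (lap u) x = 0 := by
    intro x hx
    rw [hll x (hne hx), op4, hz _ _ hx, hz _ _ hx, hz _ _ hx]; ring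
  have hlrad : IsRadial (lap u) := by
    intro x y hxy
    by_cases hx : x = 0
    · have : y = 0 := by rw [hx, norm_zero] at hxy; exact norm_eq_zero.mp hxy.symm
      rw [hx, this]
    · have hy : y ≠ 0 := by
        rw [← norm_ne_zero_iff, ← hxy]; exact norm_ne_zero_iff.mpr hx
      rw [hl x hx, hl y hy, hxy]
  have ray : ∀ r : ℝ, 0 < r → r • e0 ≠ 0 ∧ ‖r • e0‖ = r := by
    intro r hr
    have : ‖r • e0‖ = r := by rw [norm_smul, norm_e0, mul_one, Real.norm_eq_abs, abs_of_pos hr]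
    exact ⟨by rw [← norm_ne_zero_iff, this]; exact hr.ne', this⟩
  have bcongr : ∀ {f g : ℝ → ℝ}, Bd f → (∀ r, 0 < r → g r = f r) → Bd g := by
    rintro f g ⟨c, R', C', h1, h2⟩ h
    refine ⟨c.congr h, max R' 1, C', fun r hr => by rw [h r hr]; exact h1 r hr, fun r hr => ?_⟩
    have : 1 ≤ r := (le_max_right _ _).trans hr
    rw [h r (by linarith)]
    exact h2 r ((le_max_left _ _).trans hr)
  have b0 : Bd (fun r => p 0 (r^2)) := bcongr (bd_ray hu hR1) fun r hr => by
    rw [h0 _ (ray r hr).1, (ray r hr).2]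
  have b1 : Bd (fun r => p 1 (r^2)) :=
    bd_first hu hR1 hrad h0 (hall 0) (hcont 1) (hz 1)
  have hlu := contDiff_lap hu
  have B2 : Bd (fun r => op2 p (r^2)) := bcongr (bd_ray hlu hlR) fun r hr => by
    rw [hl _ (ray r hr).1, (ray r hr).2]
  have B3 : Bd (fun r => 4 * r^2 * p 3 (r^2) + 18 * p 2 (r^2)) := by
    refine bd_first (p1 := fun t => 4 * t * p 3 t + 18 * p 2 t) hlu hlR hlrad hl hjet.op2_der ?_ ?_
    · exact ((continuousOn_const.mul continuousOn_id).mul (hcont 3)).add (continuousOn_const.mul (hcont 2))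
    · intro r hr; rw [hz _ _ hr, hz _ _ hr]; ring
  have B4 : Bd (fun r => op4 p (r^2)) := bcongr (bd_ray (contDiff_lap hlu) hllR) fun r hr => by
    rw [hll _ (ray r hr).1, (ray r hr).2]
  have b2 : Bd (fun r => r^2 * p 2 (r^2)) :=
    bcongr ((B2.const_mul (1/4)).add (b1.const_mul (-14/4))) fun r _ => by
      simp only [op2]; ring
  have b3 : Bd (fun r => r^4 * p 3 (r^2)) :=
    bcongr (((B3.pow_mul 2).const_mul (1/4)).add (b2.const_mul (-18/4))) fun r _ => by ring
  have b4 : Bd (fun r => r^6 * p 4 (r^2)) :=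
    bcongr ((((B4.pow_mul 2).const_mul (1/16)).add (b3.const_mul (-9))).add (b2.const_mul (-252/16)))
      fun r _ => by simp only [op4]; ring
  exact ⟨p, h0, hjet, hcont 4, b0, b1, b2, b3, b4⟩

/-! ### One-dimensional integral estimates -/

theorem Bd.congr {f g : ℝ → ℝ} (hf : Bd f) (h : ∀ r, 0 < r → g r = f r) : Bd g := by
  obtain ⟨c, R', C', h1, h2⟩ := hf
  refine ⟨c.congr h, max R' 1, C', fun r hr => by rw [h r hr]; exact h1 r hr, fun r hr => ?_⟩
  have : 1 ≤ r := (le_max_right _ _).trans hr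
  rw [h r (by linarith)]
  exact h2 r ((le_max_left _ _).trans hr)

theorem integral_deriv_zero {Q D : ℝ → ℝ} (hQ : Bd Q) (hD : Bd D)
    (hder : ∀ r, 0 < r → HasDerivAt (fun r => r * Q r) (D r) r) : ∫ r in Ioi (0:ℝ), D r = 0 := by
  have hint := hD.integrableOn
  obtain ⟨-, R, C, h1, h2⟩ := hQ
  have hlim : Filter.Tendsto (fun r => r * Q r) Filter.atTop (nhds 0) := by
    refine tendsto_const_nhds.congr' ?_
    filter_upwards [Filter.eventually_ge_atTop R] with r hr
    rw [h2 r hr, mul_zero]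
  have hcont : ContinuousWithinAt (fun r => r * Q r) (Ici 0) 0 := by
    have h0 : Filter.Tendsto (fun r : ℝ => C * |r|) (nhdsWithin 0 (Ici 0)) (nhds 0) := by
      have : Continuous (fun r : ℝ => C * |r|) := by fun_prop
      have h := this.tendsto 0
      simp only [abs_zero, mul_zero] at h
      exact h.mono_left nhdsWithin_le_nhds
    unfold ContinuousWithinAt
    simp only [zero_mul]
    refine squeeze_zero_norm' ?_ h0
    filter_upwards [self_mem_nhdsWithin] with r hr
    rcases eq_or_lt_of_le (show (0:ℝ) ≤ r from hr) with h | h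
    · rw [← h]; simp
    · rw [norm_mul, mul_comm]
      exact mul_le_mul_of_nonneg_right (h1 r h) (norm_nonneg _)
  have := integral_Ioi_of_hasDerivAt_of_tendsto hcont (fun r hr => hder r hr) hint hlim
  simpa using this

theorem sup_bound {P D Q : ℝ → ℝ} (hP : Bd P) (hD : Bd D) (hQ : Bd Q)
    (hder : ∀ r, 0 < r → HasDerivAt P (D r) r) (hle : ∀ r, 0 < r → |D r| ≤ Q r) :
    ∀ r, 0 < r → P r ≤ ∫ s in Ioi (0:ℝ), Q s := by
  intro r hr
  have hint := hD.integrableOn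
  have hsub : Ioi r ⊆ Ioi (0:ℝ) := Ioi_subset_Ioi hr.le
  obtain ⟨-, R, C, h1, h2⟩ := hP
  have hlim : Filter.Tendsto P Filter.atTop (nhds 0) := by
    refine tendsto_const_nhds.congr' ?_
    filter_upwards [Filter.eventually_ge_atTop R] with r hr
    rw [h2 r hr]
  have h := integral_Ioi_of_hasDerivAt_of_tendsto' (a := r)
    (fun x hx => hder x (lt_of_lt_of_le hr hx)) (hint.mono_set hsub) hlim
  calc P r = - ∫ s in Ioi r, D s := by rw [h]; ring
    _ = ∫ s in Ioi r, - D s := (integral_neg _).symm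
    _ ≤ ∫ s in Ioi r, Q s := by
        refine setIntegral_mono_on (hint.mono_set hsub).neg (hQ.integrableOn.mono_set hsub)
          measurableSet_Ioi fun s hs => ?_
        exact (neg_le_abs _).trans (hle s (hsub hs))
    _ ≤ ∫ s in Ioi 0, Q s := by
        refine setIntegral_mono_set hQ.integrableOn ?_ (Filter.Eventually.of_forall hsub)
        filter_upwards [ae_restrict_mem measurableSet_Ioi] with s hs
        exact (abs_nonneg _).trans (hle s hs)

theorem pow_interp {r : ℝ} (hr : 0 < r) {m k n : ℕ} (h1 : m ≤ k) (h2 : k ≤ n) :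
    r^k ≤ r^m + r^n := by
  rcases le_total r 1 with h | h
  · have := pow_le_pow_of_le_one hr.le h h1
    have : 0 < r^n := by positivity
    linarith
  · have := pow_le_pow_right₀ h h2
    have : 0 < r^m := by positivity
    linarith

/-- The energy density. -/
def dens (p : ℕ → ℝ → ℝ) (r : ℝ) : ℝ :=
  (p 0 (r^2))^2 + r^2 * (p 0 (r^2))^2 + r^2 * (p 1 (r^2))^2 + r^6 * (p 1 (r^2))^2
  + r^6 * (p 2 (r^2))^2 + r^10 * (p 2 (r^2))^2 + r^10 * (p 3 (r^2))^2 + r^14 * (p 4 (r^2))^2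

def energy (p : ℕ → ℝ → ℝ) : ℝ :=
  ∫ r in Ioi (0:ℝ), r^6 * ((op2 p (r^2))^2 + (op4 p (r^2))^2)

theorem Prof.bd_energy {p : ℕ → ℝ → ℝ} (hp : Prof p) :
    Bd (fun r => r^6 * ((op2 p (r^2))^2 + (op4 p (r^2))^2)) := by
  have h2 : Bd (fun r => op2 p (r^2)) :=
    ((hp.b2.const_mul 4).add (hp.b1.const_mul 14)).congr fun r _ => by simp only [op2]; ring
  have h4 : Bd (fun r => r^2 * op4 p (r^2)) :=
    (((hp.b4.const_mul 16).add (hp.b3.const_mul 144)).add (hp.b2.const_mul 252)).congr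
      fun r _ => by simp only [op4]; ring
  exact (((h2.mul h2).pow_mul 6).add ((h4.mul h4).pow_mul 2)).congr fun r _ => by ring

theorem Prof.bd_dens {p : ℕ → ℝ → ℝ} (hp : Prof p) : Bd (dens p) := by
  have a := hp.b0.mul hp.b0
  have b := hp.b1.mul hp.b1
  have c := hp.b2.mul hp.b2
  have d := hp.b3.mul hp.b3
  have e := hp.b4.mul hp.b4
  refine (((((((a.add (a.pow_mul 2)).add (b.pow_mul 2)).add (b.pow_mul 6)).add (c.pow_mul 2)).add
    (c.pow_mul 6)).add (d.pow_mul 2)).add (e.pow_mul 2)).congr fun r _ => ?_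
  simp only [dens]; ring

theorem dens_nonneg (p : ℕ → ℝ → ℝ) (r : ℝ) : 0 ≤ dens p r := by
  unfold dens; positivity

theorem Prof.hd {p : ℕ → ℝ → ℝ} (hp : Prof p) {k : ℕ} (hk : k < 4) {r : ℝ} (hr : 0 < r) :
    HasDerivAt (fun s => p k (s^2)) (2 * r * p (k+1) (r^2)) r := by
  have := (hp.jet.der k hk (r^2) (by positivity)).comp r (hasDerivAt_pow 2 r)
  refine this.congr_deriv ?_
  simp; ring

theorem hd_pow {v : ℝ → ℝ} {w r : ℝ} (n : ℕ) (h : HasDerivAt v (2 * r * w) r) :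
    HasDerivAt (fun s => s^(n+1) * (v s)^2) ((n+1) * r^n * (v r)^2 + 4 * r^(n+2) * (v r * w)) r := by
  have := (hasDerivAt_pow (n+1) r).mul (h.pow 2)
  refine this.congr_deriv ?_
  simp; ring

theorem pointwise_cert (r a b c d e : ℝ) (hr : 0 < r) :
    a^2 + r^2*a^2 + r^2*b^2 + r^6*b^2 + r^6*c^2 + r^10*c^2 + r^10*d^2 + r^14*e^2
    ≤ 2 * (r^6 * ((4*r^2*c+14*b)^2 + (16*(r^2)^2*e + 144*r^2*d+252*c)^2))
      + (-(2/7*43.5) * (7 * r^6 * b^2 + 4 * r^8 * (b*c))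
        + -(2/7*(10.75+2525.75/121)) *
          (7 * r^6 * (4*r^2*d+18*c)^2 + 4 * r^8 * ((4*r^2*d+18*c)*(4*r^2*e+22*d)))
        + -(2/11*2525.75) * (7 * r^6 * c^2 + 4 * r^8 * (c*d))
        + 8.5 * (3 * r^2 * b^2 + 4 * r^4 * (b*c))
        + 0.5 * (3 * r^2 * a^2 + 4 * r^4 * (a*b))
        + 2 * (a^2 + 4 * r^2 * (a*b))) := by
  set g0 := 4*r^2*c+14*b with hg0
  set g1 := 4*r^2*d+18*c with hg1
  set g2 := 4*r^2*e+22*d with hg2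
  set h := 16*(r^2)^2*e + 144*r^2*d+252*c with hh
  have h6 : 0 < r^6 := by positivity
  have E1 : r^6*b^2 ≤ r^6*g0^2/49 - 2/7*(7 * r^6 * b^2 + 4 * r^8 * (b*c)) := by
    have : 0 ≤ r^6 * (g0 - 7*b)^2 := by positivity
    have e : r^6*g0^2/49 - 2/7*(7 * r^6 * b^2 + 4 * r^8 * (b*c)) - r^6*b^2
      = r^6 * (g0 - 7*b)^2 / 49 := by rw [hg0]; ring
    linarith
  have E2 : r^10*c^2 ≤ r^6*g0^2/8 + 24.5*(r^6*b^2) := by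
    have : 0 ≤ r^6 * (g0 + 14*b)^2 := by positivity
    have e : r^6*g0^2/8 + 24.5*(r^6*b^2) - r^10*c^2 = r^6 * (g0 + 14*b)^2/16 := by
      rw [hg0]; ring
    linarith
  have E3 : r^6*g1^2 ≤ r^6*h^2/49 - 2/7*(7 * r^6 * g1^2 + 4 * r^8 * (g1*g2)) := by
    have : 0 ≤ r^6 * (h - 7*g1)^2 := by positivity
    have e : r^6*h^2/49 - 2/7*(7 * r^6 * g1^2 + 4 * r^8 * (g1*g2)) - r^6*g1^2
      = r^6 * (h - 7*g1)^2 / 49 := by rw [hh, hg1, hg2]; ring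
    linarith
  have E4 : r^6*c^2 ≤ r^6*g1^2/121 - 2/11*(7 * r^6 * c^2 + 4 * r^8 * (c*d)) := by
    have : 0 ≤ r^6 * (g1 - 11*c)^2 := by positivity
    have e : r^6*g1^2/121 - 2/11*(7 * r^6 * c^2 + 4 * r^8 * (c*d)) - r^6*c^2
      = r^6 * (g1 - 11*c)^2 / 121 := by rw [hg1]; ring
    linarith
  have E5 : r^10*d^2 ≤ r^6*g1^2/8 + 40.5*(r^6*c^2) := by
    have : 0 ≤ r^6 * (g1 + 18*c)^2 := by positivity
    have e : r^6*g1^2/8 + 40.5*(r^6*c^2) - r^10*d^2 = r^6 * (g1 + 18*c)^2/16 := by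
      rw [hg1]; ring
    linarith
  have E6 : r^10*g2^2 ≤ r^6*h^2/8 + 24.5*(r^6*g1^2) := by
    have : 0 ≤ r^6 * (h + 14*g1)^2 := by positivity
    have e : r^6*h^2/8 + 24.5*(r^6*g1^2) - r^10*g2^2 = r^6 * (h + 14*g1)^2/16 := by
      rw [hh, hg1, hg2]; ring
    linarith
  have E7' : r^14*e^2 ≤ r^10*g2^2/8 + 60.5*(r^10*d^2) := by
    have : 0 ≤ r^10 * (g2 + 22*d)^2 := by positivity
    have e : r^10*g2^2/8 + 60.5*(r^10*d^2) - r^14*e^2 = r^10 * (g2 + 22*d)^2/16 := by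
      rw [hg2]; ring
    linarith
  have E8 : r^2*b^2 ≤ 2*(r^6*c^2) + 0.5*(3 * r^2 * b^2 + 4 * r^4 * (b*c)) := by
    have : 0 ≤ r^2*(b + 2*r^2*c)^2 := by positivity
    nlinarith [this]
  have E9 : r^2*a^2 ≤ 2*(r^6*b^2) + 0.5*(3 * r^2 * a^2 + 4 * r^4 * (a*b)) := by
    have : 0 ≤ r^2*(a + 2*r^2*b)^2 := by positivity
    nlinarith [this]
  have E10 : a^2 ≤ 16*(r^2*b^2 + r^6*b^2) + 2*(a^2 + 4 * r^2 * (a*b)) := by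
    have : 0 ≤ (a + 4*r^2*b)^2 := by positivity
    have i := mul_le_mul_of_nonneg_right (pow_interp hr (show 2 ≤ 4 by norm_num) (show 4 ≤ 6 by norm_num))
      (sq_nonneg b)
    nlinarith [this]
  have p1 : 0 ≤ r^6*g0^2 := by positivity
  have p2 : 0 ≤ r^6*h^2 := by positivity
  norm_num at *
  linarith

theorem Prof.integral_dens {p : ℕ → ℝ → ℝ} (hp : Prof p) :
    ∫ r in Ioi (0:ℝ), dens p r ≤ 2 * energy p := by
  have aa := hp.b0.mul hp.b0
  have bb := hp.b1.mul hp.b1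
  have cc := hp.b2.mul hp.b2
  have cd := hp.b2.mul hp.b3
  have ab := hp.b0.mul hp.b1
  have bc := hp.b1.mul hp.b2
  have G1 : Bd (fun r => r^2 * (4*r^2*p 3 (r^2) + 18*p 2 (r^2))) :=
    ((hp.b3.const_mul 4).add (hp.b2.const_mul 18)).congr fun r _ => by ring
  have G2 : Bd (fun r => r^4 * (4*r^2*p 4 (r^2) + 22*p 3 (r^2))) :=
    ((hp.b4.const_mul 4).add (hp.b3.const_mul 22)).congr fun r _ => by ring
  have gg := G1.mul G1
  have g12 := G1.mul G2
  set D1 : ℝ → ℝ := fun r => 7 * r^6 * (p 1 (r^2))^2 + 4 * r^8 * (p 1 (r^2) * p 2 (r^2)) with hD1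
  set D2 : ℝ → ℝ := fun r => 7 * r^6 * (4*r^2*p 3 (r^2)+18*p 2 (r^2))^2
    + 4 * r^8 * ((4*r^2*p 3 (r^2)+18*p 2 (r^2)) * (4*r^2*p 4 (r^2)+22*p 3 (r^2))) with hD2
  set D3 : ℝ → ℝ := fun r => 7 * r^6 * (p 2 (r^2))^2 + 4 * r^8 * (p 2 (r^2) * p 3 (r^2)) with hD3
  set D4 : ℝ → ℝ := fun r => 3 * r^2 * (p 1 (r^2))^2 + 4 * r^4 * (p 1 (r^2) * p 2 (r^2)) with hD4
  set D5 : ℝ → ℝ := fun r => 3 * r^2 * (p 0 (r^2))^2 + 4 * r^4 * (p 0 (r^2) * p 1 (r^2)) with hD5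
  set D6 : ℝ → ℝ := fun r => (p 0 (r^2))^2 + 4 * r^2 * (p 0 (r^2) * p 1 (r^2)) with hD6
  have B1 : Bd D1 := (((bb.pow_mul 6).const_mul 7).add ((bc.pow_mul 6).const_mul 4)).congr
    fun r _ => by simp only [hD1]; ring
  have B2 : Bd D2 := (((gg.pow_mul 2).const_mul 7).add ((g12.pow_mul 2).const_mul 4)).congr
    fun r _ => by simp only [hD2]; ring
  have B3 : Bd D3 := (((cc.pow_mul 2).const_mul 7).add ((cd.pow_mul 2).const_mul 4)).congr
    fun r _ => by simp only [hD3]; ring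
  have B4 : Bd D4 := (((bb.pow_mul 2).const_mul 3).add ((bc.pow_mul 2).const_mul 4)).congr
    fun r _ => by simp only [hD4]; ring
  have B5 : Bd D5 := (((aa.pow_mul 2).const_mul 3).add ((ab.pow_mul 4).const_mul 4)).congr
    fun r _ => by simp only [hD5]; ring
  have B6 : Bd D6 := (aa.add ((ab.pow_mul 2).const_mul 4)).congr
    fun r _ => by simp only [hD6]; ring
  have Z1 : ∫ r in Ioi (0:ℝ), D1 r = 0 := by
    refine integral_deriv_zero (bb.pow_mul 6) B1 fun r hr => ?_
    have h := hd_pow 6 (hp.hd (k := 1) (by norm_num) hr)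
    refine (h.congr_deriv ?_).congr_of_eventuallyEq (Filter.Eventually.of_forall fun s => ?_)
    · simp only [hD1]; norm_num
    · ring
  have Z2 : ∫ r in Ioi (0:ℝ), D2 r = 0 := by
    refine integral_deriv_zero (gg.pow_mul 2) B2 fun r hr => ?_
    have h0 : HasDerivAt (fun r => 4*r^2*p 3 (r^2)+18*p 2 (r^2))
        (2 * r * (4*r^2*p 4 (r^2)+22*p 3 (r^2))) r := by
      have := (((hasDerivAt_pow 2 r).const_mul 4).mul (hp.hd (k := 3) (by norm_num) hr)).add
        ((hp.hd (k := 2) (by norm_num) hr).const_mul 18)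
      refine this.congr_deriv ?_
      simp; ring
    have h := hd_pow 6 h0
    refine (h.congr_deriv ?_).congr_of_eventuallyEq (Filter.Eventually.of_forall fun s => ?_)
    · simp only [hD2]; norm_num
    · ring
  have Z3 : ∫ r in Ioi (0:ℝ), D3 r = 0 := by
    refine integral_deriv_zero (cc.pow_mul 2) B3 fun r hr => ?_
    have h := hd_pow 6 (hp.hd (k := 2) (by norm_num) hr)
    refine (h.congr_deriv ?_).congr_of_eventuallyEq (Filter.Eventually.of_forall fun s => ?_)
    · simp only [hD3]; norm_num
    · ring
  have Z4 : ∫ r in Ioi (0:ℝ), D4 r = 0 := by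
    refine integral_deriv_zero (bb.pow_mul 2) B4 fun r hr => ?_
    have h := hd_pow 2 (hp.hd (k := 1) (by norm_num) hr)
    refine (h.congr_deriv ?_).congr_of_eventuallyEq (Filter.Eventually.of_forall fun s => ?_)
    · simp only [hD4]; norm_num
    · ring
  have Z5 : ∫ r in Ioi (0:ℝ), D5 r = 0 := by
    refine integral_deriv_zero (aa.pow_mul 2) B5 fun r hr => ?_
    have h := hd_pow 2 (hp.hd (k := 0) (by norm_num) hr)
    refine (h.congr_deriv ?_).congr_of_eventuallyEq (Filter.Eventually.of_forall fun s => ?_)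
    · simp only [hD5]; norm_num
    · ring
  have Z6 : ∫ r in Ioi (0:ℝ), D6 r = 0 := by
    refine integral_deriv_zero aa B6 fun r hr => ?_
    have h := hd_pow 0 (hp.hd (k := 0) (by norm_num) hr)
    refine (h.congr_deriv ?_).congr_of_eventuallyEq (Filter.Eventually.of_forall fun s => ?_)
    · simp only [hD6]; norm_num
    · ring
  have I0 := hp.bd_energy.integrableOn.const_mul 2
  have I1 := B1.integrableOn.const_mul (-(2/7*43.5))
  have I2 := B2.integrableOn.const_mul (-(2/7*(10.75+2525.75/121)))
  have I3 := B3.integrableOn.const_mul (-(2/11*2525.75))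
  have I4 := B4.integrableOn.const_mul (8.5:ℝ)
  have I5 := B5.integrableOn.const_mul (0.5:ℝ)
  have I6 := B6.integrableOn.const_mul 2
  have J := ((((I1.add I2).add I3).add I4).add I5).add I6
  have hmono := setIntegral_mono_on hp.bd_dens.integrableOn (I0.add J) measurableSet_Ioi
    (fun r hr => pointwise_cert r (p 0 (r^2)) (p 1 (r^2)) (p 2 (r^2)) (p 3 (r^2)) (p 4 (r^2)) hr)
  refine hmono.trans (le_of_eq ?_)
  rw [integral_add' I0 J, integral_add' ((((I1.add I2).add I3).add I4).add I5) I6,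
    integral_add' (((I1.add I2).add I3).add I4) I5, integral_add' ((I1.add I2).add I3) I4,
    integral_add' (I1.add I2) I3, integral_add' I1 I2]
  rw [integral_const_mul, integral_const_mul, integral_const_mul, integral_const_mul,
    integral_const_mul, integral_const_mul, integral_const_mul, Z1, Z2, Z3, Z4, Z5, Z6]
  simp [energy]

/-! ### Pointwise bounds -/

structure SupB (p : ℕ → ℝ → ℝ) (r K : ℝ) : Prop where
  s0 : (p 0 (r^2))^2 ≤ K
  s0' : r^3 * (p 0 (r^2))^2 ≤ K
  s1 : r^4 * (p 1 (r^2))^2 ≤ K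
  s1' : r^7 * (p 1 (r^2))^2 ≤ K
  s2 : r^8 * (p 2 (r^2))^2 ≤ K
  s2' : r^9 * (p 2 (r^2))^2 ≤ K

theorem two_mul_abs_le (x y : ℝ) : 2 * |x * y| ≤ x^2 + y^2 := by
  rw [abs_mul, ← sq_abs x, ← sq_abs y]
  nlinarith [sq_nonneg (|x| - |y|)]

theorem Prof.sup {p : ℕ → ℝ → ℝ} (hp : Prof p) {r : ℝ} (hr : 0 < r) :
    SupB p r (40 * energy p) := by
  have aa := hp.b0.mul hp.b0
  have bb := hp.b1.mul hp.b1
  have cc := hp.b2.mul hp.b2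
  have cd := hp.b2.mul hp.b3
  have ab := hp.b0.mul hp.b1
  have bc := hp.b1.mul hp.b2
  have hQ := hp.bd_dens.const_mul 20
  have hI : ∫ s in Ioi (0:ℝ), 20 * dens p s ≤ 40 * energy p := by
    rw [integral_const_mul]; linarith [hp.integral_dens]
  have key : ∀ {s : ℝ} (n : ℕ) (k : ℕ), 0 < s → 0 ≤ s^n * (p k (s^2))^2 := fun n k hs => by positivity
  refine ⟨?_, ?_, ?_, ?_, ?_, ?_⟩
  · refine (sup_bound (P := fun r => (p 0 (r^2))^2)
      (D := fun r => 4 * r^1 * (p 0 (r^2) * p 1 (r^2)))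
      (aa.congr fun s _ => by ring) (((ab.pow_mul 1).const_mul 4).congr fun s _ => by ring) hQ
      (fun s hs => ?_) (fun s hs => ?_) r hr).trans hI
    · refine ((hp.hd (k := 0) (by norm_num) hs).pow 2).congr_deriv ?_
      simp; ring
    · have h := two_mul_abs_le (p 0 (s^2)) (s * p 1 (s^2))
      have e : 4 * s^1 * (p 0 (s^2) * p 1 (s^2)) = 4 * (p 0 (s^2) * (s * p 1 (s^2))) := by ring
      beta_reduce
      rw [e, abs_mul, abs_of_pos (by norm_num : (0:ℝ) < 4)]
      unfold dens
      linarith [key 2 0 hs, key 2 1 hs, key 6 1 hs, key 6 2 hs, key 10 2 hs, key 10 3 hs, key 14 4 hs,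
        sq_nonneg (p 0 (s^2)), mul_pow s (p 1 (s^2)) 2]
  · refine (sup_bound (P := fun r => r^3 * (p 0 (r^2))^2)
      (D := fun r => 3 * r^2 * (p 0 (r^2))^2 + 4 * r^4 * (p 0 (r^2) * p 1 (r^2)))
      ((aa.pow_mul 3).congr fun s _ => by ring)
      ((((aa.pow_mul 2).const_mul 3).add ((ab.pow_mul 4).const_mul 4)).congr fun s _ => by ring) hQ
      (fun s hs => ?_) (fun s hs => ?_) r hr).trans hI
    · refine (hd_pow 2 (hp.hd (k := 0) (by norm_num) hs)).congr_deriv ?_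
      norm_num
    · have h := two_mul_abs_le (s * p 0 (s^2)) (s^3 * p 1 (s^2))
      have e : 3 * s^2 * (p 0 (s^2))^2 + 4 * s^4 * (p 0 (s^2) * p 1 (s^2))
        = 3 * (s^2 * (p 0 (s^2))^2) + 4 * ((s * p 0 (s^2)) * (s^3 * p 1 (s^2))) := by ring
      beta_reduce
      rw [e]
      refine (abs_add_le _ _).trans ?_
      rw [abs_mul, abs_mul 4, abs_of_pos (by norm_num : (0:ℝ) < 4), abs_of_pos (by norm_num : (0:ℝ) < 3),
        abs_of_nonneg (key 2 0 hs)]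
      have e1 : (s * p 0 (s^2))^2 = s^2 * (p 0 (s^2))^2 := by ring
      have e2 : (s^3 * p 1 (s^2))^2 = s^6 * (p 1 (s^2))^2 := by ring
      unfold dens
      linarith [key 2 0 hs, key 2 1 hs, key 6 1 hs, key 6 2 hs, key 10 2 hs, key 10 3 hs, key 14 4 hs,
        sq_nonneg (p 0 (s^2))]
  · refine (sup_bound (P := fun r => r^4 * (p 1 (r^2))^2)
      (D := fun r => 4 * r^3 * (p 1 (r^2))^2 + 4 * r^5 * (p 1 (r^2) * p 2 (r^2)))
      ((bb.pow_mul 4).congr fun s _ => by ring)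
      ((((bb.pow_mul 3).const_mul 4).add ((bc.pow_mul 3).const_mul 4)).congr fun s _ => by ring) hQ
      (fun s hs => ?_) (fun s hs => ?_) r hr).trans hI
    · refine (hd_pow 3 (hp.hd (k := 1) (by norm_num) hs)).congr_deriv ?_
      norm_num
    · have h := two_mul_abs_le (s^2 * p 1 (s^2)) (s^3 * p 2 (s^2))
      have e : 4 * s^3 * (p 1 (s^2))^2 + 4 * s^5 * (p 1 (s^2) * p 2 (s^2))
        = 4 * (s^3 * (p 1 (s^2))^2) + 4 * ((s^2 * p 1 (s^2)) * (s^3 * p 2 (s^2))) := by ring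
      beta_reduce
      rw [e]
      refine (abs_add_le _ _).trans ?_
      rw [abs_mul, abs_mul 4, abs_of_pos (by norm_num : (0:ℝ) < 4),
        abs_of_nonneg (key 3 1 hs)]
      have e1 : (s^2 * p 1 (s^2))^2 = s^4 * (p 1 (s^2))^2 := by ring
      have e2 : (s^3 * p 2 (s^2))^2 = s^6 * (p 2 (s^2))^2 := by ring
      have i3 := mul_le_mul_of_nonneg_right (pow_interp hs (show 2 ≤ 3 by norm_num)
        (show 3 ≤ 6 by norm_num)) (sq_nonneg (p 1 (s^2)))
      have i4 := mul_le_mul_of_nonneg_right (pow_interp hs (show 2 ≤ 4 by norm_num)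
        (show 4 ≤ 6 by norm_num)) (sq_nonneg (p 1 (s^2)))
      unfold dens
      linarith [key 2 0 hs, key 2 1 hs, key 6 1 hs, key 6 2 hs, key 10 2 hs, key 10 3 hs, key 14 4 hs,
        sq_nonneg (p 0 (s^2))]
  · refine (sup_bound (P := fun r => r^7 * (p 1 (r^2))^2)
      (D := fun r => 7 * r^6 * (p 1 (r^2))^2 + 4 * r^8 * (p 1 (r^2) * p 2 (r^2)))
      ((bb.pow_mul 7).congr fun s _ => by ring)
      ((((bb.pow_mul 6).const_mul 7).add ((bc.pow_mul 6).const_mul 4)).congr fun s _ => by ring) hQ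
      (fun s hs => ?_) (fun s hs => ?_) r hr).trans hI
    · refine (hd_pow 6 (hp.hd (k := 1) (by norm_num) hs)).congr_deriv ?_
      norm_num
    · have h := two_mul_abs_le (s^3 * p 1 (s^2)) (s^5 * p 2 (s^2))
      have e : 7 * s^6 * (p 1 (s^2))^2 + 4 * s^8 * (p 1 (s^2) * p 2 (s^2))
        = 7 * (s^6 * (p 1 (s^2))^2) + 4 * ((s^3 * p 1 (s^2)) * (s^5 * p 2 (s^2))) := by ring
      beta_reduce
      rw [e]
      refine (abs_add_le _ _).trans ?_
      rw [abs_mul, abs_mul 4, abs_of_pos (by norm_num : (0:ℝ) < 4), abs_of_pos (by norm_num : (0:ℝ) < 7),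
        abs_of_nonneg (key 6 1 hs)]
      have e1 : (s^3 * p 1 (s^2))^2 = s^6 * (p 1 (s^2))^2 := by ring
      have e2 : (s^5 * p 2 (s^2))^2 = s^10 * (p 2 (s^2))^2 := by ring
      unfold dens
      linarith [key 2 0 hs, key 2 1 hs, key 6 1 hs, key 6 2 hs, key 10 2 hs, key 10 3 hs, key 14 4 hs,
        sq_nonneg (p 0 (s^2))]
  · refine (sup_bound (P := fun r => r^8 * (p 2 (r^2))^2)
      (D := fun r => 8 * r^7 * (p 2 (r^2))^2 + 4 * r^9 * (p 2 (r^2) * p 3 (r^2)))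
      ((cc.pow_mul 4).congr fun s _ => by ring)
      ((((cc.pow_mul 3).const_mul 8).add ((cd.pow_mul 3).const_mul 4)).congr fun s _ => by ring) hQ
      (fun s hs => ?_) (fun s hs => ?_) r hr).trans hI
    · refine (hd_pow 7 (hp.hd (k := 2) (by norm_num) hs)).congr_deriv ?_
      norm_num
    · have h := two_mul_abs_le (s^4 * p 2 (s^2)) (s^5 * p 3 (s^2))
      have e : 8 * s^7 * (p 2 (s^2))^2 + 4 * s^9 * (p 2 (s^2) * p 3 (s^2))
        = 8 * (s^7 * (p 2 (s^2))^2) + 4 * ((s^4 * p 2 (s^2)) * (s^5 * p 3 (s^2))) := by ring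
      beta_reduce
      rw [e]
      refine (abs_add_le _ _).trans ?_
      rw [abs_mul, abs_mul 4, abs_of_pos (by norm_num : (0:ℝ) < 4), abs_of_pos (by norm_num : (0:ℝ) < 8),
        abs_of_nonneg (key 7 2 hs)]
      have e1 : (s^4 * p 2 (s^2))^2 = s^8 * (p 2 (s^2))^2 := by ring
      have e2 : (s^5 * p 3 (s^2))^2 = s^10 * (p 3 (s^2))^2 := by ring
      have i3 := mul_le_mul_of_nonneg_right (pow_interp hs (show 6 ≤ 7 by norm_num)
        (show 7 ≤ 10 by norm_num)) (sq_nonneg (p 2 (s^2)))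
      have i4 := mul_le_mul_of_nonneg_right (pow_interp hs (show 6 ≤ 8 by norm_num)
        (show 8 ≤ 10 by norm_num)) (sq_nonneg (p 2 (s^2)))
      unfold dens
      linarith [key 2 0 hs, key 2 1 hs, key 6 1 hs, key 6 2 hs, key 10 2 hs, key 10 3 hs, key 14 4 hs,
        sq_nonneg (p 0 (s^2))]
  · refine (sup_bound (P := fun r => r^9 * (p 2 (r^2))^2)
      (D := fun r => 9 * r^8 * (p 2 (r^2))^2 + 4 * r^10 * (p 2 (r^2) * p 3 (r^2)))
      ((cc.pow_mul 5).congr fun s _ => by ring)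
      ((((cc.pow_mul 4).const_mul 9).add ((cd.pow_mul 4).const_mul 4)).congr fun s _ => by ring) hQ
      (fun s hs => ?_) (fun s hs => ?_) r hr).trans hI
    · refine (hd_pow 8 (hp.hd (k := 2) (by norm_num) hs)).congr_deriv ?_
      norm_num
    · have h := two_mul_abs_le (s^5 * p 2 (s^2)) (s^5 * p 3 (s^2))
      have e : 9 * s^8 * (p 2 (s^2))^2 + 4 * s^10 * (p 2 (s^2) * p 3 (s^2))
        = 9 * (s^8 * (p 2 (s^2))^2) + 4 * ((s^5 * p 2 (s^2)) * (s^5 * p 3 (s^2))) := by ring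
      beta_reduce
      rw [e]
      refine (abs_add_le _ _).trans ?_
      rw [abs_mul, abs_mul 4, abs_of_pos (by norm_num : (0:ℝ) < 4), abs_of_pos (by norm_num : (0:ℝ) < 9),
        abs_of_nonneg (key 8 2 hs)]
      have e1 : (s^5 * p 2 (s^2))^2 = s^10 * (p 2 (s^2))^2 := by ring
      have e2 : (s^5 * p 3 (s^2))^2 = s^10 * (p 3 (s^2))^2 := by ring
      have i4 := mul_le_mul_of_nonneg_right (pow_interp hs (show 6 ≤ 8 by norm_num)
        (show 8 ≤ 10 by norm_num)) (sq_nonneg (p 2 (s^2)))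
      unfold dens
      linarith [key 2 0 hs, key 2 1 hs, key 6 1 hs, key 6 2 hs, key 10 2 hs, key 10 3 hs, key 14 4 hs,
        sq_nonneg (p 0 (s^2))]

/-! ### Products, pointwise -/

structure DenB (p : ℕ → ℝ → ℝ) (r E : ℝ) : Prop where
  d0 : r^2 * (p 0 (r^2))^2 ≤ E
  d1 : r^2 * (p 1 (r^2))^2 ≤ E
  d1' : r^6 * (p 1 (r^2))^2 ≤ E
  d2 : r^6 * (p 2 (r^2))^2 ≤ E
  d2' : r^10 * (p 2 (r^2))^2 ≤ E
  d3 : r^10 * (p 3 (r^2))^2 ≤ E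
  d4 : r^14 * (p 4 (r^2))^2 ≤ E

theorem denB_dens (p : ℕ → ℝ → ℝ) (r : ℝ) (hr : 0 < r) : DenB p r (dens p r) := by
  have key : ∀ (n : ℕ) (k : ℕ), 0 ≤ r^n * (p k (r^2))^2 := fun n k => by positivity
  have h := sq_nonneg (p 0 (r^2))
  constructor <;> unfold dens <;>
  linarith [key 2 0, key 2 1, key 6 1, key 6 2, key 10 2, key 10 3, key 14 4]

theorem sq2 (x y : ℝ) : (x + y)^2 ≤ 2 * (x^2 + y^2) := by nlinarith [sq_nonneg (x - y)]
theorem sq3 (x y z : ℝ) : (x + y + z)^2 ≤ 3 * (x^2 + y^2 + z^2) := by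
  nlinarith [sq_nonneg (x - y), sq_nonneg (x - z), sq_nonneg (y - z)]
theorem sq4 (x y z w : ℝ) : (x + y + z + w)^2 ≤ 4 * (x^2 + y^2 + z^2 + w^2) := by
  linarith [sq2 (x + y) (z + w), sq2 x y, sq2 z w, congrArg (· ^ 2) (add_assoc (x + y) z w)]
theorem sq5 (x y z w v : ℝ) : (x + y + z + w + v)^2 ≤ 5 * (x^2 + y^2 + z^2 + w^2 + v^2) := by
  nlinarith [sq_nonneg (x - y), sq_nonneg (x - z), sq_nonneg (y - z), sq_nonneg (x - w),
    sq_nonneg (y - w), sq_nonneg (z - w), sq_nonneg (x - v), sq_nonneg (y - v), sq_nonneg (z - v),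
    sq_nonneg (w - v)]

theorem tm {r x y X Y : ℝ} (hr : 0 < r) (i j n : ℕ) (h : i + j = n)
    (hx : r^i * x^2 ≤ X) (hy : r^j * y^2 ≤ Y) : r^n * (x * y)^2 ≤ X * Y := by
  have e : r^n * (x*y)^2 = (r^i * x^2) * (r^j * y^2) := by rw [← h]; ring
  rw [e]
  exact mul_le_mul hx hy (by positivity) (le_trans (by positivity) hx)

theorem SupB.K_nonneg {a : ℕ → ℝ → ℝ} {r K : ℝ} (h : SupB a r K) : 0 ≤ K :=
  (sq_nonneg _).trans h.s0

theorem DenB.E_nonneg {a : ℕ → ℝ → ℝ} {r E : ℝ} (hr : 0 < r) (h : DenB a r E) : 0 ≤ E :=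
  le_trans (by positivity) h.d0

theorem SupB.i0 {a : ℕ → ℝ → ℝ} {r K : ℝ} (hr : 0 < r) (h : SupB a r K) :
    r^1 * (a 0 (r^2))^2 ≤ 2 * K := by
  have i := mul_le_mul_of_nonneg_right (pow_interp hr (show 0 ≤ 1 by norm_num)
    (show 1 ≤ 3 by norm_num)) (sq_nonneg (a 0 (r^2)))
  linarith [h.s0, h.s0', i, pow_zero r, congrArg (· * (a 0 (r^2))^2) (pow_zero r)]

theorem SupB.i1 {a : ℕ → ℝ → ℝ} {r K : ℝ} (hr : 0 < r) (h : SupB a r K) :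
    r^5 * (a 1 (r^2))^2 ≤ 2 * K := by
  have i := mul_le_mul_of_nonneg_right (pow_interp hr (show 4 ≤ 5 by norm_num)
    (show 5 ≤ 7 by norm_num)) (sq_nonneg (a 1 (r^2)))
  linarith [h.s1, h.s1', i]

theorem SupB.z0 {a : ℕ → ℝ → ℝ} {r K : ℝ} (h : SupB a r K) : r^0 * (a 0 (r^2))^2 ≤ K := by
  simpa using h.s0

theorem mul_denB {a b : ℕ → ℝ → ℝ} {r Ka Kb Ea Eb : ℝ} (hr : 0 < r)
    (ha : SupB a r Ka) (hb : SupB b r Kb) (da : DenB a r Ea) (db : DenB b r Eb) :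
    DenB (mulJet a b) r (300 * (Ka * Eb + Ea * Kb)) := by
  have h1 : 0 ≤ Ka * Eb := mul_nonneg ha.K_nonneg (db.E_nonneg hr)
  have h2 : 0 ≤ Ea * Kb := mul_nonneg (da.E_nonneg hr) hb.K_nonneg
  constructor
  · have t0 := tm hr 0 2 2 rfl ha.z0 db.d0
    simp only [mulJet]
    linarith
  · have q := mul_le_mul_of_nonneg_left (sq2 (a 1 (r^2) * b 0 (r^2)) (a 0 (r^2) * b 1 (r^2))) (pow_nonneg hr.le 2)
    have t0 := tm hr 2 0 2 rfl da.d1 hb.z0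
    have t1 := tm hr 0 2 2 rfl ha.z0 db.d1
    simp only [mulJet]
    linarith [t0, t1, h1, h2]
  · have q := mul_le_mul_of_nonneg_left (sq2 (a 1 (r^2) * b 0 (r^2)) (a 0 (r^2) * b 1 (r^2))) (pow_nonneg hr.le 6)
    have t0 := tm hr 6 0 6 rfl da.d1' hb.z0
    have t1 := tm hr 0 6 6 rfl ha.z0 db.d1'
    simp only [mulJet]
    linarith [t0, t1, h1, h2]
  · have q := mul_le_mul_of_nonneg_left (sq3 (a 2 (r^2) * b 0 (r^2)) (2 * (a 1 (r^2) * b 1 (r^2))) (a 0 (r^2) * b 2 (r^2))) (pow_nonneg hr.le 6)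
    have t0 := tm hr 6 0 6 rfl da.d2 hb.z0
    have t1 := tm hr 4 2 6 rfl ha.s1 db.d1
    have t2 := tm hr 0 6 6 rfl ha.z0 db.d2
    simp only [mulJet]
    linarith [t0, t1, t2, h1, h2]
  · have q := mul_le_mul_of_nonneg_left (sq3 (a 2 (r^2) * b 0 (r^2)) (2 * (a 1 (r^2) * b 1 (r^2))) (a 0 (r^2) * b 2 (r^2))) (pow_nonneg hr.le 10)
    have t0 := tm hr 10 0 10 rfl da.d2' hb.z0
    have t1 := tm hr 4 6 10 rfl ha.s1 db.d1'
    have t2 := tm hr 0 10 10 rfl ha.z0 db.d2'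
    simp only [mulJet]
    linarith [t0, t1, t2, h1, h2]
  · have q := mul_le_mul_of_nonneg_left (sq4 (a 3 (r^2) * b 0 (r^2)) (3 * (a 2 (r^2) * b 1 (r^2))) (3 * (a 1 (r^2) * b 2 (r^2))) (a 0 (r^2) * b 3 (r^2))) (pow_nonneg hr.le 10)
    have t0 := tm hr 10 0 10 rfl da.d3 hb.z0
    have t1 := tm hr 6 4 10 rfl da.d2 hb.s1
    have t2 := tm hr 4 6 10 rfl ha.s1 db.d2
    have t3 := tm hr 0 10 10 rfl ha.z0 db.d3
    simp only [mulJet]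
    linarith [t0, t1, t2, t3, h1, h2]
  · have q := mul_le_mul_of_nonneg_left (sq5 (a 4 (r^2) * b 0 (r^2)) (4 * (a 3 (r^2) * b 1 (r^2))) (6 * (a 2 (r^2) * b 2 (r^2))) (4 * (a 1 (r^2) * b 3 (r^2))) (a 0 (r^2) * b 4 (r^2))) (pow_nonneg hr.le 14)
    have t0 := tm hr 14 0 14 rfl da.d4 hb.z0
    have t1 := tm hr 10 4 14 rfl da.d3 hb.s1
    have t2 := tm hr 8 6 14 rfl ha.s2 db.d2
    have t3 := tm hr 4 10 14 rfl ha.s1 db.d3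
    have t4 := tm hr 0 14 14 rfl ha.z0 db.d4
    simp only [mulJet]
    linarith [t0, t1, t2, t3, t4, h1, h2]

/-- the extra decay of a product -/
structure DenX (p : ℕ → ℝ → ℝ) (r E : ℝ) : Prop where
  x1 : r^3 * (p 1 (r^2))^2 ≤ E
  x2 : r^7 * (p 2 (r^2))^2 ≤ E
  x3 : r^11 * (p 3 (r^2))^2 ≤ E
  x4 : r^15 * (p 4 (r^2))^2 ≤ E

theorem mul_denX {a b : ℕ → ℝ → ℝ} {r Ka Kb Ea Eb : ℝ} (hr : 0 < r)
    (ha : SupB a r Ka) (hb : SupB b r Kb) (da : DenB a r Ea) (db : DenB b r Eb) :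
    DenX (mulJet a b) r (400 * (Ka * Eb + Ea * Kb)) := by
  have h1 : 0 ≤ Ka * Eb := mul_nonneg ha.K_nonneg (db.E_nonneg hr)
  have h2 : 0 ≤ Ea * Kb := mul_nonneg (da.E_nonneg hr) hb.K_nonneg
  constructor
  · have q := mul_le_mul_of_nonneg_left (sq2 (a 1 (r^2) * b 0 (r^2)) (a 0 (r^2) * b 1 (r^2))) (pow_nonneg hr.le 3)
    have t0 := tm hr 2 1 3 rfl da.d1 (hb.i0 hr)
    have t1 := tm hr 1 2 3 rfl (ha.i0 hr) db.d1
    simp only [mulJet]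
    linarith [t0, t1, h1, h2]
  · have q := mul_le_mul_of_nonneg_left (sq3 (a 2 (r^2) * b 0 (r^2)) (2 * (a 1 (r^2) * b 1 (r^2))) (a 0 (r^2) * b 2 (r^2))) (pow_nonneg hr.le 7)
    have t0 := tm hr 6 1 7 rfl da.d2 (hb.i0 hr)
    have t1 := tm hr 5 2 7 rfl (ha.i1 hr) db.d1
    have t2 := tm hr 1 6 7 rfl (ha.i0 hr) db.d2
    simp only [mulJet]
    linarith [t0, t1, t2, h1, h2]
  · have q := mul_le_mul_of_nonneg_left (sq4 (a 3 (r^2) * b 0 (r^2)) (3 * (a 2 (r^2) * b 1 (r^2))) (3 * (a 1 (r^2) * b 2 (r^2))) (a 0 (r^2) * b 3 (r^2))) (pow_nonneg hr.le 11)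
    have t0 := tm hr 10 1 11 rfl da.d3 (hb.i0 hr)
    have t1 := tm hr 6 5 11 rfl da.d2 (hb.i1 hr)
    have t2 := tm hr 5 6 11 rfl (ha.i1 hr) db.d2
    have t3 := tm hr 1 10 11 rfl (ha.i0 hr) db.d3
    simp only [mulJet]
    linarith [t0, t1, t2, t3, h1, h2]
  · have q := mul_le_mul_of_nonneg_left (sq5 (a 4 (r^2) * b 0 (r^2)) (4 * (a 3 (r^2) * b 1 (r^2))) (6 * (a 2 (r^2) * b 2 (r^2))) (4 * (a 1 (r^2) * b 3 (r^2))) (a 0 (r^2) * b 4 (r^2))) (pow_nonneg hr.le 15)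
    have t0 := tm hr 14 1 15 rfl da.d4 (hb.i0 hr)
    have t1 := tm hr 10 5 15 rfl da.d3 (hb.i1 hr)
    have t2 := tm hr 9 6 15 rfl ha.s2' db.d2
    have t3 := tm hr 5 10 15 rfl (ha.i1 hr) db.d3
    have t4 := tm hr 1 14 15 rfl (ha.i0 hr) db.d4
    simp only [mulJet]
    linarith [t0, t1, t2, t3, t4, h1, h2]

/-- the pointwise decay of a product -/
structure SupX (p : ℕ → ℝ → ℝ) (r K : ℝ) : Prop where
  y0 : r^4 * (p 0 (r^2))^2 ≤ K
  y1 : r^8 * (p 1 (r^2))^2 ≤ K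
  y2 : r^12 * (p 2 (r^2))^2 ≤ K

theorem mul_supX {a b : ℕ → ℝ → ℝ} {r Ka Kb : ℝ} (hr : 0 < r)
    (ha : SupB a r Ka) (hb : SupB b r Kb) : SupX (mulJet a b) r (100 * (Ka * Kb)) := by
  have h1 : 0 ≤ Ka * Kb := mul_nonneg ha.K_nonneg hb.K_nonneg
  have h2 := h1
  constructor
  · have t0 := tm hr 3 1 4 rfl ha.s0' (hb.i0 hr)
    simp only [mulJet]
    linarith
  · have q := mul_le_mul_of_nonneg_left (sq2 (a 1 (r^2) * b 0 (r^2)) (a 0 (r^2) * b 1 (r^2))) (pow_nonneg hr.le 8)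
    have t0 := tm hr 7 1 8 rfl ha.s1' (hb.i0 hr)
    have t1 := tm hr 1 7 8 rfl (ha.i0 hr) hb.s1'
    simp only [mulJet]
    linarith [t0, t1, h1, h2]
  · have q := mul_le_mul_of_nonneg_left (sq3 (a 2 (r^2) * b 0 (r^2)) (2 * (a 1 (r^2) * b 1 (r^2))) (a 0 (r^2) * b 2 (r^2))) (pow_nonneg hr.le 12)
    have t0 := tm hr 9 3 12 rfl ha.s2' hb.s0'
    have t1 := tm hr 7 5 12 rfl ha.s1' (hb.i1 hr)
    have t2 := tm hr 3 9 12 rfl ha.s0' hb.s2'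
    simp only [mulJet]
    linarith [t0, t1, t2, h1, h2]

/-- what is needed of a triple product -/
structure Trip (q : ℕ → ℝ → ℝ) (r E : ℝ) : Prop where
  q00 : r^6 * (q 0 (r^2))^2 ≤ E
  q10 : r^10 * (q 1 (r^2))^2 ≤ E
  q20 : r^14 * (q 2 (r^2))^2 ≤ E
  q11 : r^6 * (q 1 (r^2))^2 ≤ E
  q21 : r^10 * (q 2 (r^2))^2 ≤ E
  q31 : r^14 * (q 3 (r^2))^2 ≤ E
  q41 : r^18 * (q 4 (r^2))^2 ≤ E

theorem mul_trip {z c : ℕ → ℝ → ℝ} {r K E Kc Ec : ℝ} (hr : 0 < r)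
    (hz : SupX z r K) (xz : DenX z r E) (hc : SupB c r Kc) (dc : DenB c r Ec) :
    Trip (mulJet z c) r (300 * (K * Ec + E * Kc)) := by
  have h1 : 0 ≤ K * Ec := mul_nonneg (le_trans (by positivity) hz.y0) (dc.E_nonneg hr)
  have h2 : 0 ≤ E * Kc := mul_nonneg (le_trans (by positivity) xz.x1) hc.K_nonneg
  constructor
  · have t0 := tm hr 4 2 6 rfl hz.y0 dc.d0
    simp only [mulJet]
    linarith
  · have q := mul_le_mul_of_nonneg_left (sq2 (z 1 (r^2) * c 0 (r^2)) (z 0 (r^2) * c 1 (r^2))) (pow_nonneg hr.le 10)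
    have t0 := tm hr 8 2 10 rfl hz.y1 dc.d0
    have t1 := tm hr 4 6 10 rfl hz.y0 dc.d1'
    simp only [mulJet]
    linarith [t0, t1, h1, h2]
  · have q := mul_le_mul_of_nonneg_left (sq3 (z 2 (r^2) * c 0 (r^2)) (2 * (z 1 (r^2) * c 1 (r^2))) (z 0 (r^2) * c 2 (r^2))) (pow_nonneg hr.le 14)
    have t0 := tm hr 12 2 14 rfl hz.y2 dc.d0
    have t1 := tm hr 8 6 14 rfl hz.y1 dc.d1'
    have t2 := tm hr 4 10 14 rfl hz.y0 dc.d2'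
    simp only [mulJet]
    linarith [t0, t1, t2, h1, h2]
  · have q := mul_le_mul_of_nonneg_left (sq2 (z 1 (r^2) * c 0 (r^2)) (z 0 (r^2) * c 1 (r^2))) (pow_nonneg hr.le 6)
    have t0 := tm hr 3 3 6 rfl xz.x1 hc.s0'
    have t1 := tm hr 4 2 6 rfl hz.y0 dc.d1
    simp only [mulJet]
    linarith [t0, t1, h1, h2]
  · have q := mul_le_mul_of_nonneg_left (sq3 (z 2 (r^2) * c 0 (r^2)) (2 * (z 1 (r^2) * c 1 (r^2))) (z 0 (r^2) * c 2 (r^2))) (pow_nonneg hr.le 10)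
    have t0 := tm hr 7 3 10 rfl xz.x2 hc.s0'
    have t1 := tm hr 8 2 10 rfl hz.y1 dc.d1
    have t2 := tm hr 4 6 10 rfl hz.y0 dc.d2
    simp only [mulJet]
    linarith [t0, t1, t2, h1, h2]
  · have q := mul_le_mul_of_nonneg_left (sq4 (z 3 (r^2) * c 0 (r^2)) (3 * (z 2 (r^2) * c 1 (r^2))) (3 * (z 1 (r^2) * c 2 (r^2))) (z 0 (r^2) * c 3 (r^2))) (pow_nonneg hr.le 14)
    have t0 := tm hr 11 3 14 rfl xz.x3 hc.s0'
    have t1 := tm hr 7 7 14 rfl xz.x2 hc.s1'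
    have t2 := tm hr 8 6 14 rfl hz.y1 dc.d2
    have t3 := tm hr 4 10 14 rfl hz.y0 dc.d3
    simp only [mulJet]
    linarith [t0, t1, t2, t3, h1, h2]
  · have q := mul_le_mul_of_nonneg_left (sq5 (z 4 (r^2) * c 0 (r^2)) (4 * (z 3 (r^2) * c 1 (r^2))) (6 * (z 2 (r^2) * c 2 (r^2))) (4 * (z 1 (r^2) * c 3 (r^2))) (z 0 (r^2) * c 4 (r^2))) (pow_nonneg hr.le 18)
    have t0 := tm hr 15 3 18 rfl xz.x4 hc.s0'
    have t1 := tm hr 11 7 18 rfl xz.x3 hc.s1'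
    have t2 := tm hr 12 6 18 rfl hz.y2 dc.d2
    have t3 := tm hr 8 10 18 rfl hz.y1 dc.d3
    have t4 := tm hr 4 14 18 rfl hz.y0 dc.d4
    simp only [mulJet]
    linarith [t0, t1, t2, t3, t4, h1, h2]

/-! ### The multiplier -/

theorem fb (c : ℝ) (i j m : ℕ) (hm : i + j = m) : ∃ B : ℝ, 0 ≤ B ∧ ∀ r : ℝ, 0 < r →
    r^(4*i) * (c * ((a1 * r^2 + a2)⁻¹)^m)^2 ≤ B := by
  have h1 := a1_pos
  have h2 := a2_pos
  refine ⟨(c * ((1/a1)^i * (1/a2)^j))^2, sq_nonneg _, fun r hr => ?_⟩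
  set x := (a1 * r^2 + a2)⁻¹ with hx
  have hpos : 0 < a1 * r^2 + a2 := by positivity
  have x0 : 0 ≤ x := by positivity
  have x1 : x ≤ 1/a2 := by
    rw [hx, ← one_div]
    exact one_div_le_one_div_of_le h2 (by nlinarith [mul_pos h1 (pow_pos hr 2)])
  have y1 : r^2 * x ≤ 1/a1 := by
    rw [hx, ← div_eq_mul_inv, div_le_div_iff₀ hpos h1]
    nlinarith
  have e : r^(4*i) * (c * x^m)^2 = c^2 * ((r^2*x)^i * x^j)^2 := by
    rw [← hm, mul_pow (r^2) x i, ← pow_mul, pow_add]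
    ring
  rw [e, mul_pow c]
  have : (r^2*x)^i * x^j ≤ (1/a1)^i * (1/a2)^j :=
    mul_le_mul (pow_le_pow_left₀ (by positivity) y1 i) (pow_le_pow_left₀ x0 x1 j)
      (by positivity) (by positivity)
  exact mul_le_mul_of_nonneg_left (pow_le_pow_left₀ (by positivity) this 2) (sq_nonneg c)

structure FB (r B : ℝ) : Prop where
  g0 : r^0 * (fJet 0 (r^2))^2 ≤ B
  g1 : r^4 * (fJet 1 (r^2))^2 ≤ B
  g2 : r^4 * (fJet 2 (r^2))^2 ≤ B
  g2' : r^8 * (fJet 2 (r^2))^2 ≤ B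
  g3 : r^8 * (fJet 3 (r^2))^2 ≤ B
  g3' : r^12 * (fJet 3 (r^2))^2 ≤ B
  g4 : r^12 * (fJet 4 (r^2))^2 ≤ B

theorem exists_FB : ∃ B : ℝ, 0 < B ∧ ∀ r : ℝ, 0 < r → FB r B := by
  obtain ⟨B0, p0, h0⟩ := fb (-(9 * (a2/a1))) 0 1 1 rfl
  obtain ⟨B1, p1, h1⟩ := fb (9 * a2) 1 1 2 rfl
  obtain ⟨B2, p2, h2⟩ := fb (-18 * a2 * a1) 1 2 3 rfl
  obtain ⟨B3, p3, h3⟩ := fb (-18 * a2 * a1) 2 1 3 rfl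
  obtain ⟨B4, p4, h4⟩ := fb (54 * a2 * a1^2) 2 2 4 rfl
  obtain ⟨B5, p5, h5⟩ := fb (54 * a2 * a1^2) 3 1 4 rfl
  obtain ⟨B6, p6, h6⟩ := fb (-216 * a2 * a1^3) 3 2 5 rfl
  have hc := sq_nonneg (-9 * (1 - 1/a1))
  refine ⟨1 + 2 * ((-9 * (1 - 1/a1))^2) + 2 * B0 + B1 + B2 + B3 + B4 + B5 + B6, by linarith,
    fun r hr => ?_⟩
  have h0 := h0 r hr
  have h1 := h1 r hr
  have h2 := h2 r hr
  have h3 := h3 r hr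
  have h4 := h4 r hr
  have h5 := h5 r hr
  have h6 := h6 r hr
  norm_num at h0 h1 h2 h3 h4 h5 h6 
  constructor <;> simp only [fJet]
  · have := sq2 (-9 * (1 - 1/a1)) (-(9 * (a2/a1)) * (a1 * r^2 + a2)⁻¹)
    have e : (-9 * (1 - 1/a1) - 9 * (a2/a1) * (a1 * r^2 + a2)⁻¹) =
      (-9 * (1 - 1/a1) + -(9 * (a2/a1)) * (a1 * r^2 + a2)⁻¹) := by ring
    rw [e, pow_zero, one_mul]
    have e2 : (-(9 * (a2/a1)) * (a1 * r^2 + a2)⁻¹)^2 = (9 * (a2/a1) * (a1 * r^2 + a2)⁻¹)^2 := by ring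
    linarith
  · rw [inv_pow]; linarith
  · rw [inv_pow]; linarith
  · rw [inv_pow]; linarith
  · rw [inv_pow]; linarith
  · rw [inv_pow]; linarith
  · rw [inv_pow]; linarith

def Sd (p : ℕ → ℝ → ℝ) (r : ℝ) : ℝ := r^6 * ((op2 p (r^2))^2 + (op4 p (r^2))^2)

theorem quad_bound {z : ℕ → ℝ → ℝ} {r B E : ℝ} (hr : 0 < r) (hf : FB r B) (dz : DenB z r E) :
    Sd (mulJet fJet z) r ≤ 10^7 * (B * E) := by
  have h1 : 0 ≤ B * E := mul_nonneg (le_trans (by positivity) hf.g0) (dz.E_nonneg hr)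
  set a := fJet
  set b := z
  have F1 : r^6 * (mulJet a b 1 (r^2))^2 ≤ 4 * (B * E) := by
    have q := mul_le_mul_of_nonneg_left (sq2 (a 1 (r^2) * b 0 (r^2)) (a 0 (r^2) * b 1 (r^2))) (pow_nonneg hr.le 6)
    have t0 := tm hr 4 2 6 rfl hf.g1 dz.d0
    have t1 := tm hr 0 6 6 rfl hf.g0 dz.d1'
    simp only [mulJet]
    linarith [t0, t1, h1]
  have F2 : r^6 * (mulJet a b 2 (r^2))^2 ≤ 18 * (B * E) := by
    have q := mul_le_mul_of_nonneg_left (sq3 (a 2 (r^2) * b 0 (r^2)) (2 * (a 1 (r^2) * b 1 (r^2))) (a 0 (r^2) * b 2 (r^2))) (pow_nonneg hr.le 6)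
    have t0 := tm hr 4 2 6 rfl hf.g2 dz.d0
    have t1 := tm hr 4 2 6 rfl hf.g1 dz.d1
    have t2 := tm hr 0 6 6 rfl hf.g0 dz.d2
    simp only [mulJet]
    linarith [t0, t1, t2, h1]
  have F2' : r^10 * (mulJet a b 2 (r^2))^2 ≤ 18 * (B * E) := by
    have q := mul_le_mul_of_nonneg_left (sq3 (a 2 (r^2) * b 0 (r^2)) (2 * (a 1 (r^2) * b 1 (r^2))) (a 0 (r^2) * b 2 (r^2))) (pow_nonneg hr.le 10)
    have t0 := tm hr 8 2 10 rfl hf.g2' dz.d0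
    have t1 := tm hr 4 6 10 rfl hf.g1 dz.d1'
    have t2 := tm hr 0 10 10 rfl hf.g0 dz.d2'
    simp only [mulJet]
    linarith [t0, t1, t2, h1]
  have F3 : r^10 * (mulJet a b 3 (r^2))^2 ≤ 80 * (B * E) := by
    have q := mul_le_mul_of_nonneg_left (sq4 (a 3 (r^2) * b 0 (r^2)) (3 * (a 2 (r^2) * b 1 (r^2))) (3 * (a 1 (r^2) * b 2 (r^2))) (a 0 (r^2) * b 3 (r^2))) (pow_nonneg hr.le 10)
    have t0 := tm hr 8 2 10 rfl hf.g3 dz.d0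
    have t1 := tm hr 8 2 10 rfl hf.g2' dz.d1
    have t2 := tm hr 4 6 10 rfl hf.g1 dz.d2
    have t3 := tm hr 0 10 10 rfl hf.g0 dz.d3
    simp only [mulJet]
    linarith [t0, t1, t2, t3, h1]
  have F4 : r^14 * (mulJet a b 4 (r^2))^2 ≤ 350 * (B * E) := by
    have q := mul_le_mul_of_nonneg_left (sq5 (a 4 (r^2) * b 0 (r^2)) (4 * (a 3 (r^2) * b 1 (r^2))) (6 * (a 2 (r^2) * b 2 (r^2))) (4 * (a 1 (r^2) * b 3 (r^2))) (a 0 (r^2) * b 4 (r^2))) (pow_nonneg hr.le 14)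
    have t0 := tm hr 12 2 14 rfl hf.g4 dz.d0
    have t1 := tm hr 12 2 14 rfl hf.g3' dz.d1
    have t2 := tm hr 8 6 14 rfl hf.g2' dz.d2
    have t3 := tm hr 4 10 14 rfl hf.g1 dz.d3
    have t4 := tm hr 0 14 14 rfl hf.g0 dz.d4
    simp only [mulJet]
    linarith [t0, t1, t2, t3, t4, h1]
  unfold Sd op2 op4
  generalize mulJet a b 1 (r^2) = G1 at *
  generalize mulJet a b 2 (r^2) = G2 at *
  generalize mulJet a b 3 (r^2) = G3 at *
  generalize mulJet a b 4 (r^2) = G4 at *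
  have s1 := mul_le_mul_of_nonneg_left (sq2 (4 * r^2 * G2) (14 * G1)) (pow_nonneg hr.le 6)
  have s2 := mul_le_mul_of_nonneg_left
    (sq3 (16 * (r^2)^2 * G4) (144 * r^2 * G3) (252 * G2)) (pow_nonneg hr.le 6)
  linarith [F1, F2, F2', F3, F4, s1, s2, h1]

theorem cubic_bound {q : ℕ → ℝ → ℝ} {r E : ℝ} (hr : 0 < r) (h : Trip q r E) :
    Sd (mulJet tJet q) r ≤ 10^7 * E := by
  have h1 : 0 ≤ E := le_trans (by positivity) h.q00
  have e2 : op2 (mulJet tJet q) (r^2) = 4 * r^4 * q 2 (r^2) + 22 * r^2 * q 1 (r^2) + 14 * q 0 (r^2) := by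
    simp only [op2, mulJet, tJet]; ring
  have e4 : op4 (mulJet tJet q) (r^2) = 16 * r^6 * q 4 (r^2) + 208 * r^4 * q 3 (r^2)
      + 684 * r^2 * q 2 (r^2) + 504 * q 1 (r^2) := by
    simp only [op4, mulJet, tJet]; ring
  have s1 := mul_le_mul_of_nonneg_left (sq3 (4 * r^4 * q 2 (r^2)) (22 * r^2 * q 1 (r^2))
    (14 * q 0 (r^2))) (pow_nonneg hr.le 6)
  have s2 := mul_le_mul_of_nonneg_left (sq4 (16 * r^6 * q 4 (r^2)) (208 * r^4 * q 3 (r^2))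
    (684 * r^2 * q 2 (r^2)) (504 * q 1 (r^2))) (pow_nonneg hr.le 6)
  unfold Sd
  rw [e2, e4]
  linarith [h.q00, h.q10, h.q20, h.q11, h.q21, h.q31, h.q41]

/-- the jet of the difference of the nonlinearities -/
def totJet (w a b : ℕ → ℝ → ℝ) : ℕ → ℝ → ℝ := fun k t =>
  mulJet fJet (mulJet w a) k t + mulJet fJet (mulJet w b) k t
  + (-3 * mulJet tJet (mulJet (mulJet w a) a) k t + -3 * mulJet tJet (mulJet (mulJet w a) b) k t
    + -3 * mulJet tJet (mulJet (mulJet w b) b) k t)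

theorem Jet.smul {a : ℕ → ℝ → ℝ} (ha : Jet a) (c : ℝ) : Jet (fun k t => c * a k t) :=
  ⟨fun k hk t ht => (ha.der k hk t ht).const_mul c⟩

theorem totJet_jet {w a b : ℕ → ℝ → ℝ} (hw : Jet w) (ha : Jet a) (hb : Jet b) :
    Jet (totJet w a b) :=
  ((fJet_jet.mul (hw.mul ha)).add (fJet_jet.mul (hw.mul hb))).add
    ((((tJet_jet.mul ((hw.mul ha).mul ha)).smul (-3)).add
      ((tJet_jet.mul ((hw.mul ha).mul hb)).smul (-3))).add
      ((tJet_jet.mul ((hw.mul hb).mul hb)).smul (-3)))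

theorem Sd_tot (w a b : ℕ → ℝ → ℝ) {r : ℝ} (hr : 0 < r) : Sd (totJet w a b) r ≤
    5 * Sd (mulJet fJet (mulJet w a)) r + 5 * Sd (mulJet fJet (mulJet w b)) r
    + 45 * Sd (mulJet tJet (mulJet (mulJet w a) a)) r
    + 45 * Sd (mulJet tJet (mulJet (mulJet w a) b)) r
    + 45 * Sd (mulJet tJet (mulJet (mulJet w b) b)) r := by
  unfold totJet
  generalize mulJet fJet (mulJet w a) = A
  generalize mulJet fJet (mulJet w b) = B
  generalize mulJet tJet (mulJet (mulJet w a) a) = C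
  generalize mulJet tJet (mulJet (mulJet w a) b) = D
  generalize mulJet tJet (mulJet (mulJet w b) b) = F
  have e2 : op2 (fun k t => A k t + B k t + (-3 * C k t + -3 * D k t + -3 * F k t)) (r^2)
      = op2 A (r^2) + op2 B (r^2) + (-3 * op2 C (r^2)) + (-3 * op2 D (r^2)) + (-3 * op2 F (r^2)) := by
    simp only [op2]; ring
  have e4 : op4 (fun k t => A k t + B k t + (-3 * C k t + -3 * D k t + -3 * F k t)) (r^2)
      = op4 A (r^2) + op4 B (r^2) + (-3 * op4 C (r^2)) + (-3 * op4 D (r^2)) + (-3 * op4 F (r^2)) := by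
    simp only [op4]; ring
  unfold Sd
  rw [e2, e4]
  have s1 := mul_le_mul_of_nonneg_left (sq5 (op2 A (r^2)) (op2 B (r^2)) (-3 * op2 C (r^2))
    (-3 * op2 D (r^2)) (-3 * op2 F (r^2))) (pow_nonneg hr.le 6)
  have s2 := mul_le_mul_of_nonneg_left (sq5 (op4 A (r^2)) (op4 B (r^2)) (-3 * op4 C (r^2))
    (-3 * op4 D (r^2)) (-3 * op4 F (r^2))) (pow_nonneg hr.le 6)
  linarith [s1, s2]

/-- the model density -/
def Dn (w a : ℕ → ℝ → ℝ) (r : ℝ) : ℝ := energy w * dens a r + energy a * dens w r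

theorem Prof.energy_nonneg {p : ℕ → ℝ → ℝ} (hp : Prof p) : 0 ≤ energy p := by
  have := (hp.sup one_pos).K_nonneg
  linarith

theorem Dn_nonneg {w a : ℕ → ℝ → ℝ} (hw : Prof w) (ha : Prof a) (r : ℝ) : 0 ≤ Dn w a r :=
  add_nonneg (mul_nonneg hw.energy_nonneg (dens_nonneg _ _))
    (mul_nonneg ha.energy_nonneg (dens_nonneg _ _))

theorem bd_Dn {w a : ℕ → ℝ → ℝ} (hw : Prof w) (ha : Prof a) : Bd (Dn w a) :=
  (ha.bd_dens.const_mul _).add (hw.bd_dens.const_mul _)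

theorem integral_Dn {w a : ℕ → ℝ → ℝ} (hw : Prof w) (ha : Prof a) :
    ∫ r in Ioi (0:ℝ), Dn w a r ≤ 4 * (energy w * energy a) := by
  unfold Dn
  rw [integral_add (ha.bd_dens.const_mul _).integrableOn (hw.bd_dens.const_mul _).integrableOn,
    integral_const_mul, integral_const_mul]
  have h1 := mul_le_mul_of_nonneg_left ha.integral_dens hw.energy_nonneg
  have h2 := mul_le_mul_of_nonneg_left hw.integral_dens ha.energy_nonneg
  linarith

theorem quad_Dn {w a : ℕ → ℝ → ℝ} (hw : Prof w) (ha : Prof a) {r B : ℝ} (hr : 0 < r)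
    (hf : FB r B) : Sd (mulJet fJet (mulJet w a)) r ≤ 10^7 * 12000 * B * Dn w a r := by
  have h := quad_bound hr hf (mul_denB hr (hw.sup hr) (ha.sup hr) (denB_dens w r hr)
    (denB_dens a r hr))
  refine h.trans (le_of_eq ?_)
  unfold Dn; ring

theorem trip_Dn {w a b : ℕ → ℝ → ℝ} (hw : Prof w) (ha : Prof a) (hb : Prof b) {r M : ℝ}
    (hr : 0 < r) (ma : energy a ≤ M) (mb : energy b ≤ M) :
    Sd (mulJet tJet (mulJet (mulJet w a) b)) r ≤
      10^7 * 192000000 * M * (Dn w a r + Dn w b r) := by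
  have h := cubic_bound hr (mul_trip hr (mul_supX hr (hw.sup hr) (ha.sup hr))
    (mul_denX hr (hw.sup hr) (ha.sup hr) (denB_dens w r hr) (denB_dens a r hr)) (hb.sup hr)
    (denB_dens b r hr))
  refine h.trans ?_
  have w0 := hw.energy_nonneg
  have b0 := hb.energy_nonneg
  have a0 := ha.energy_nonneg
  have dw := dens_nonneg w r
  have da := dens_nonneg a r
  have db := dens_nonneg b r
  have t1 := mul_le_mul_of_nonneg_right ma (mul_nonneg w0 db)
  have t2 := mul_le_mul_of_nonneg_right mb (mul_nonneg w0 da)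
  have t3 := mul_le_mul_of_nonneg_right mb (mul_nonneg a0 dw)
  have t4 := mul_nonneg (a0.trans ma) (mul_nonneg b0 dw)
  have t5 := mul_nonneg (a0.trans ma) (mul_nonneg w0 db)
  unfold Dn
  linarith [t1, t2, t3, t4, t5]

theorem tot_Dn {w a b : ℕ → ℝ → ℝ} (hw : Prof w) (ha : Prof a) (hb : Prof b) {r M B : ℝ}
    (hr : 0 < r) (hf : FB r B) (ma : energy a ≤ M) (mb : energy b ≤ M) :
    Sd (totJet w a b) r ≤ (10^12 * B + 10^18 * M) * (Dn w a r + Dn w b r) := by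
  have q1 := quad_Dn hw ha hr hf
  have q2 := quad_Dn hw hb hr hf
  have t1 := trip_Dn hw ha ha hr ma ma
  have t2 := trip_Dn hw ha hb hr ma mb
  have t3 := trip_Dn hw hb hb hr mb mb
  have s := Sd_tot w a b hr
  have B0 : 0 ≤ B := le_trans (by positivity) hf.g0
  have M0 : 0 ≤ M := ha.energy_nonneg.trans ma
  have p1 := mul_nonneg B0 (Dn_nonneg hw ha r)
  have p2 := mul_nonneg B0 (Dn_nonneg hw hb r)
  have p3 := mul_nonneg M0 (Dn_nonneg hw ha r)
  have p4 := mul_nonneg M0 (Dn_nonneg hw hb r)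
  linarith [q1, q2, t1, t2, t3, s, p1, p2, p3, p4]

/-! ### Polar coordinates -/

def c7 : ℝ := 7 * (volume : Measure E7).real (Metric.ball 0 1)

theorem c7_pos : 0 < c7 := by
  unfold c7
  have h : 0 < (volume : Measure E7).real (Metric.ball 0 1) :=
    ENNReal.toReal_pos (Metric.measure_ball_pos volume (0 : E7) one_pos).ne' measure_ball_lt_top.ne
  linarith

theorem polar_integrable {g : ℝ → ℝ} (hg : Bd (fun r => r^6 * g r)) :
    Integrable (fun x : E7 => g ‖x‖) := by
  rw [integrable_fun_norm_addHaar (volume : Measure E7)]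
  simpa using hg.integrableOn

theorem polar_integral (g : ℝ → ℝ) :
    ∫ x : E7, g ‖x‖ = c7 * ∫ r in Ioi (0:ℝ), r^6 * g r := by
  rw [integral_fun_norm_addHaar (volume : Measure E7)]
  simp [c7, mul_assoc]

theorem ae_ne_zero : ∀ᵐ x : E7, x ≠ 0 := by
  rw [ae_iff]
  simp

theorem hnormSq_le {p : ℕ → ℝ → ℝ} (hp : Jet p) {F : E7 → ℝ}
    (h0 : ∀ x, x ≠ 0 → F x = p 0 (‖x‖^2)) {D : ℝ → ℝ} (hD : Bd D)
    (hle : ∀ r, 0 < r → Sd p r ≤ D r) :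
    HnormSq F ≤ ENNReal.ofReal (c7 * ∫ r in Ioi (0:ℝ), D r) := by
  have e : ∀ r : ℝ, 0 < r → r^6 * (D r / r^6) = D r := fun r hr => by field_simp
  have hb : Bd (fun r => r^6 * (D r / r^6)) := hD.congr e
  have hi : Integrable (fun x : E7 => (fun r => D r / r^6) ‖x‖) := polar_integrable hb
  have hpt : ∀ x : E7, x ≠ 0 →
      (op2 p (‖x‖^2))^2 + (op4 p (‖x‖^2))^2 ≤ D ‖x‖ / ‖x‖^6 := by
    intro x hx
    have hx' : 0 < ‖x‖ := norm_pos_iff.2 hx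
    rw [le_div_iff₀ (by positivity)]
    have := hle _ hx'
    unfold Sd at this
    linarith
  have e1 : ∫ r in Ioi (0:ℝ), D r = ∫ r in Ioi (0:ℝ), r^6 * (D r / r^6) :=
    setIntegral_congr_fun measurableSet_Ioi fun r hr => (e r hr).symm
  have e2 := polar_integral (fun r => D r / r^6)
  rw [e1, ← e2, ofReal_integral_eq_lintegral_ofReal hi]
  · unfold HnormSq
    refine (le_lintegral_add _ _).trans (lintegral_mono_ae ?_)
    filter_upwards [ae_ne_zero] with x hx
    rw [hp.lap_eq h0 hx, hp.laplap_eq h0 hx, ← ENNReal.ofReal_add (sq_nonneg _) (sq_nonneg _)]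
    exact ENNReal.ofReal_le_ofReal (hpt x hx)
  · filter_upwards [ae_ne_zero] with x hx
    exact (add_nonneg (sq_nonneg _) (sq_nonneg _)).trans (hpt x hx)

theorem hnormSq_eq {u : E7 → ℝ} (hu : ContDiff ℝ (⊤ : ℕ∞) u) {p : ℕ → ℝ → ℝ} (hp : Prof p)
    (h0 : ∀ x, x ≠ 0 → u x = p 0 (‖x‖^2)) :
    HnormSq u = ENNReal.ofReal (c7 * energy p) := by
  have hb := hp.bd_energy
  have hi : Integrable (fun x : E7 => (fun r => (op2 p (r^2))^2 + (op4 p (r^2))^2) ‖x‖) :=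
    polar_integrable hb
  have e2 := polar_integral (fun r => (op2 p (r^2))^2 + (op4 p (r^2))^2)
  unfold energy
  rw [← e2, ofReal_integral_eq_lintegral_ofReal hi]
  · unfold HnormSq
    rw [← lintegral_add_left]
    · refine lintegral_congr_ae ?_
      filter_upwards [ae_ne_zero] with x hx
      rw [hp.jet.lap_eq h0 hx, hp.jet.laplap_eq h0 hx,
        ← ENNReal.ofReal_add (sq_nonneg _) (sq_nonneg _)]
    · exact (((contDiff_lap hu).continuous.pow 2).measurable).ennreal_ofReal
  · exact Filter.Eventually.of_forall fun x => add_nonneg (sq_nonneg _) (sq_nonneg _)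

theorem hnorm_le_one {u : E7 → ℝ} (h : Hnorm u ≤ 1) : HnormSq u ≤ 1 := by
  by_contra hc
  push Not at hc
  have := ENNReal.one_lt_rpow hc (show (0:ℝ) < 1/2 by norm_num)
  exact absurd h (not_le.2 this)

theorem energy_le {u : E7 → ℝ} {p : ℕ → ℝ → ℝ} (h : Hnorm u ≤ 1)
    (he : HnormSq u = ENNReal.ofReal (c7 * energy p)) : energy p ≤ 1 / c7 := by
  have h1 := hnorm_le_one h
  rw [he, ENNReal.ofReal_le_one] at h1
  rw [le_div_iff₀ c7_pos]
  linarith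

/-- Local Lipschitz estimate for the nonlinearity: there is `C > 0` such that for all
radial `u₁, u₂ ∈ C_c^∞(ℝ⁷,ℝ)` with `‖u₁‖ ≤ 1` and `‖u₂‖ ≤ 1`,
`‖N(u₁) − N(u₂)‖ ≤ C(‖u₁‖ + ‖u₂‖)‖u₁ − u₂‖`. -/
theorem stmt17 :
    ∃ C : ℝ, 0 < C ∧ ∀ u₁ u₂ : E7 → ℝ,
      ContDiff ℝ (⊤ : ℕ∞) u₁ → HasCompactSupport u₁ → IsRadial u₁ →
      ContDiff ℝ (⊤ : ℕ∞) u₂ → HasCompactSupport u₂ → IsRadial u₂ →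
      Hnorm u₁ ≤ 1 → Hnorm u₂ ≤ 1 →
      Hnorm (fun x => Nonlin u₁ x - Nonlin u₂ x)
        ≤ ENNReal.ofReal C * (Hnorm u₁ + Hnorm u₂) * Hnorm (fun x => u₁ x - u₂ x) := by
  obtain ⟨B, hB, hF⟩ := exists_FB
  have hc := c7_pos
  set K : ℝ := 10^12 * B + 10^18 * (1 / c7) with hK
  have K0 : 0 < K := by positivity
  have L0 : 0 < 4 * K / c7 := by positivity
  refine ⟨(4 * K / c7)^((1:ℝ)/2), Real.rpow_pos_of_pos L0 _, ?_⟩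
  intro u v hu cu ru hv cv rv nu nv
  obtain ⟨a, ha, pa⟩ := exists_prof hu cu ru
  obtain ⟨b, hb, pb⟩ := exists_prof hv cv rv
  have hwd : ContDiff ℝ (⊤ : ℕ∞) (fun x => u x - v x) := hu.sub hv
  have hwr : IsRadial (fun x => u x - v x) := fun x y h => by
    show u x - v x = u y - v y
    rw [ru x y h, rv x y h]
  have hwc : HasCompactSupport (fun x => u x - v x) := cu.sub cv
  obtain ⟨w, hw, pw⟩ := exists_prof hwd hwc hwr
  have ea := hnormSq_eq hu pa ha
  have eb := hnormSq_eq hv pb hb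
  have ew := hnormSq_eq hwd pw hw
  have ma := energy_le nu ea
  have mb := energy_le nv eb
  have hD : Bd (fun r => K * (Dn w a r + Dn w b r)) :=
    ((bd_Dn pw pa).add (bd_Dn pw pb)).const_mul K
  have h0 : ∀ x : E7, x ≠ 0 → Nonlin u x - Nonlin v x = totJet w a b 0 (‖x‖^2) := by
    intro x hx
    have e1 := ha x hx
    have e2 := hb x hx
    have e3 := hw x hx
    simp only [totJet, mulJet, Nonlin, f1_eq, f2, tJet]
    rw [← e1, ← e2, ← e3]
    ring
  have main := hnormSq_le (F := fun x => Nonlin u x - Nonlin v x)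
    (totJet_jet pw.jet pa.jet pb.jet) h0 hD
    (fun r hr => tot_Dn pw pa pb hr (hF r hr) ma mb)
  have hint : ∫ r in Ioi (0:ℝ), K * (Dn w a r + Dn w b r) ≤
      K * (4 * (energy w * energy a) + 4 * (energy w * energy b)) := by
    rw [integral_const_mul, integral_add (bd_Dn pw pa).integrableOn (bd_Dn pw pb).integrableOn]
    exact mul_le_mul_of_nonneg_left (add_le_add (integral_Dn pw pa) (integral_Dn pw pb)) K0.le
  have w0 := pw.energy_nonneg
  have b0 := pb.energy_nonneg
  have a0 := pa.energy_nonneg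
  have key : HnormSq (fun x => Nonlin u x - Nonlin v x) ≤
      ENNReal.ofReal (4 * K / c7) * (HnormSq u + HnormSq v) * HnormSq (fun x => u x - v x) := by
    rw [ea, eb, ew, ← ENNReal.ofReal_add (by positivity) (by positivity),
      ← ENNReal.ofReal_mul L0.le, ← ENNReal.ofReal_mul (by positivity)]
    refine main.trans (ENNReal.ofReal_le_ofReal ?_)
    refine (mul_le_mul_of_nonneg_left hint hc.le).trans (le_of_eq ?_)
    field_simp
  have half : (0:ℝ) ≤ 1/2 := by norm_num
  unfold Hnorm
  refine (ENNReal.rpow_le_rpow key half).trans ?_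
  rw [ENNReal.mul_rpow_of_nonneg _ _ half, ENNReal.mul_rpow_of_nonneg _ _ half,
    ENNReal.ofReal_rpow_of_nonneg L0.le half]
  gcongr
  exact ENNReal.rpow_add_le_add_rpow _ _ half (by norm_num)

end
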